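/- arXiv:0806.4329 — 3 statements merged into one kernel-verified Lean document; each statement's English description precedes it below -/
import Mathlib

section
/- Let d ∈ ℕ, 2 ≤ q ≤ p' ≤ ∞ with q not an even integer. Then there exists a positive finite Borel measure μ on ℝ^d such that, with f(t,x) = ∫_{ℝ^d} e^{−π|x−tv|²} dμ(v), the quantity Q̃_{p,q}(t) := ‖(f(t,·)^{1/p})^∧‖_{L^q(ℝ^d)} is strictly increasing for all sufficiently large t > 0. -/
open MeasureTheory Real Filter
open scoped FourierTransform ENNReal Topology

/-- The sliding gaussian superposition `f(t,x) = ∫ e^{-π|x - tv|²} dμ(v)`. -/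
noncomputable def slidingGaussian (d : ℕ) (μ : Measure (EuclideanSpace ℝ (Fin d)))
    (t : ℝ) (x : EuclideanSpace ℝ (Fin d)) : ℝ :=
  ∫ v, Real.exp (-π * ‖x - t • v‖ ^ 2) ∂μ

/-- `Q̃_{p,q}(t) = ‖(f(t,·)^{1/p})^∧‖_{L^q(ℝ^d)}`. -/
noncomputable def Qtilde (d : ℕ) (μ : Measure (EuclideanSpace ℝ (Fin d))) (p q t : ℝ) : ℝ :=
  (eLpNorm (𝓕 fun x => ((slidingGaussian d μ t x ^ (1 / p) : ℝ) : ℂ))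
    (ENNReal.ofReal q) volume).toReal


section
open scoped ContDiff

theorem sg_plancherel {d : ℕ} (u : EuclideanSpace ℝ (Fin d) → ℂ) (hu : Integrable u)
    (hu2 : MemLp u 2) :
    MemLp (𝓕 u) 2 ∧ eLpNorm (𝓕 u) 2 volume = eLpNorm u 2 volume := by
  set U : Lp (α := EuclideanSpace ℝ (Fin d)) ℂ 2 := hu2.toLp u with hU
  have hcont : Continuous (𝓕 u) := by
    exact VectorFourier.fourierIntegral_continuous Real.continuous_fourierChar
      (by exact continuous_inner) hu
  have hae : ∀ᵐ x ∂(volume : Measure (EuclideanSpace ℝ (Fin d))), (𝓕 U : Lp ℂ 2 (volume : Measure (EuclideanSpace ℝ (Fin d)))) x = 𝓕 u x := by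
    apply ae_eq_of_integral_contDiff_smul_eq
    · exact (Lp.memLp _).locallyIntegrable (by norm_num)
    · exact hcont.locallyIntegrable
    · intro g hg hgs
      have hs : HasCompactSupport (fun x => (g x : ℂ)) := hgs.comp_left (g := fun x : ℝ => (x : ℂ)) (by simp)
      have hc : ContDiff ℝ ∞ (fun x => (g x : ℂ)) := Complex.ofRealCLM.contDiff.comp hg
      let φ := hs.toSchwartzMap hc
      have h1 := congrArg (fun T => T φ) (MeasureTheory.Lp.fourier_toTemperedDistribution_eq U)
      simp only [TemperedDistribution.fourier_apply, Lp.toTemperedDistribution_apply] at h1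
      have h2 : ∫ x, (𝓕 φ) x • U x = ∫ x, 𝓕 (φ : EuclideanSpace ℝ (Fin d) → ℂ) x • u x := by
        apply integral_congr_ae
        filter_upwards [hu2.coeFn_toLp] with x hx
        rw [hx, SchwartzMap.fourier_coe]
      have h3 := VectorFourier.integral_fourierIntegral_smul_eq_flip (μ := volume) (ν := volume)
        (L := innerₗ (EuclideanSpace ℝ (Fin d))) (f := (φ : EuclideanSpace ℝ (Fin d) → ℂ)) (g := u) Real.continuous_fourierChar
        (by exact continuous_inner) φ.integrable hu
      rw [h2] at h1
      have h4 : ∫ x, 𝓕 (φ : EuclideanSpace ℝ (Fin d) → ℂ) x • u x = ∫ x, φ x • 𝓕 u x := by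
        rw [flip_innerₗ] at h3
        exact h3
      rw [h4] at h1
      simpa [φ] using h1.symm
  refine ⟨(memLp_congr_ae hae).1 (Lp.memLp _), ?_⟩
  rw [← eLpNorm_congr_ae hae]
  have h := MeasureTheory.Lp.norm_fourier_eq U
  rw [Lp.norm_def, Lp.norm_def, ENNReal.toReal_eq_toReal_iff' (Lp.eLpNorm_ne_top _) (Lp.eLpNorm_ne_top _)] at h
  rw [h, eLpNorm_congr_ae hu2.coeFn_toLp]

theorem sg_gauss_int {d : ℕ} {κ : ℝ} (hκ : 0 < κ) :
    Integrable (fun x : EuclideanSpace ℝ (Fin d) => Real.exp (-κ * ‖x‖ ^ 2)) := by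
  have h := GaussianFourier.integrable_cexp_neg_mul_sq_norm_add (V := EuclideanSpace ℝ (Fin d))
    (b := (κ : ℂ)) (by simpa using hκ) 0 0
  refine h.norm.congr (Eventually.of_forall fun x => ?_)
  simp [Complex.norm_exp]
  left
  norm_cast

theorem sg_fourier_bound {d : ℕ} {κ : ℝ} (hκ : 0 < κ) :
    ∃ c > 0, ∀ (u : EuclideanSpace ℝ (Fin d) → ℂ) (A : ℝ), Continuous u → 0 ≤ A →
      (∀ x, ‖u x‖ ≤ A * Real.exp (-κ * ‖x‖ ^ 2)) →
      Integrable u ∧ Continuous (𝓕 u) ∧ (∀ ξ, ‖𝓕 u ξ‖ ≤ A * c) ∧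
        Integrable (fun ξ => ‖𝓕 u ξ‖ ^ 2) ∧ ∫ ξ, ‖𝓕 u ξ‖ ^ 2 ≤ A ^ 2 * c := by
  have hI := sg_gauss_int (d := d) hκ
  have hI2 := sg_gauss_int (d := d) (κ := 2 * κ) (by positivity)
  set c1 := ∫ x : EuclideanSpace ℝ (Fin d), Real.exp (-κ * ‖x‖ ^ 2) with hc1
  set c2 := ∫ x : EuclideanSpace ℝ (Fin d), Real.exp (-(2 * κ) * ‖x‖ ^ 2) with hc2
  have hc1' : 0 ≤ c1 := integral_nonneg fun x => (Real.exp_pos _).le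
  have hc2' : 0 ≤ c2 := integral_nonneg fun x => (Real.exp_pos _).le
  refine ⟨c1 + c2 + 1, by positivity, fun u A hu hA hb => ?_⟩
  have hint : Integrable u := (hI.const_mul A).mono' hu.aestronglyMeasurable (Eventually.of_forall hb)
  have hcont : Continuous (𝓕 u) :=
    VectorFourier.fourierIntegral_continuous Real.continuous_fourierChar
      (by exact continuous_inner) hint
  have hsq : ∀ x, ‖u x‖ ^ 2 ≤ A ^ 2 * Real.exp (-(2 * κ) * ‖x‖ ^ 2) := by
    intro x
    calc ‖u x‖ ^ 2 ≤ (A * Real.exp (-κ * ‖x‖ ^ 2)) ^ 2 := by gcongr; exact hb x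
      _ = _ := by rw [mul_pow, ← Real.exp_nat_mul]; congr 2; push_cast; ring
  have hsqi : Integrable (fun x => ‖u x‖ ^ 2) :=
    (hI2.const_mul (A ^ 2)).mono' (by fun_prop) (Eventually.of_forall fun x => by
      rw [Real.norm_of_nonneg (by positivity)]; exact hsq x)
  have hm : MemLp u 2 := (memLp_two_iff_integrable_sq_norm hu.aestronglyMeasurable).2 hsqi
  obtain ⟨h1, h2⟩ := sg_plancherel u hint hm
  refine ⟨hint, hcont, fun ξ => ?_, ?_, ?_⟩
  · calc ‖𝓕 u ξ‖ ≤ ∫ x, ‖u x‖ := VectorFourier.norm_fourierIntegral_le_integral_norm _ _ _ _ _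
      _ ≤ ∫ x, A * Real.exp (-κ * ‖x‖ ^ 2) := integral_mono hint.norm (hI.const_mul A) hb
      _ = A * c1 := integral_const_mul _ _
      _ ≤ _ := by gcongr; linarith
  · exact (memLp_two_iff_integrable_sq_norm hcont.aestronglyMeasurable).1 h1
  · have e1 := h1.eLpNorm_eq_integral_rpow_norm (by norm_num) (by norm_num)
    have e2 := hm.eLpNorm_eq_integral_rpow_norm (by norm_num) (by norm_num)
    rw [e1, e2] at h2
    have h3 : ∫ ξ, ‖𝓕 u ξ‖ ^ 2 = ∫ x, ‖u x‖ ^ 2 := by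
      have := (ENNReal.ofReal_eq_ofReal_iff (by positivity) (by positivity)).1 h2
      have := (Real.rpow_left_inj (by positivity) (by positivity) (by norm_num)).1 this
      simpa using this
    rw [h3]
    calc ∫ x, ‖u x‖ ^ 2 ≤ ∫ x, A ^ 2 * Real.exp (-(2 * κ) * ‖x‖ ^ 2) :=
          integral_mono hsqi (hI2.const_mul _) hsq
      _ = A ^ 2 * c2 := integral_const_mul _ _
      _ ≤ _ := by gcongr; linarith

end

theorem sg_rpow_sub_le {s x y : ℝ} (hs : 1 ≤ s) (hy : 0 ≤ y) (hxy : y ≤ x) :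
    x ^ s - y ^ s ≤ s * x ^ (s - 1) * (x - y) := by
  rcases eq_or_lt_of_le hxy with h | h
  · subst h; simp
  have hx : 0 < x := lt_of_le_of_lt hy h
  obtain ⟨c, hc, hc2⟩ := exists_deriv_eq_slope (fun z : ℝ => z ^ s) h
    ((Real.continuous_rpow_const (by linarith)).continuousOn)
    ((Real.differentiable_rpow_const hs).differentiableOn)
  rw [Real.deriv_rpow_const, eq_div_iff (by linarith)] at hc2
  rw [← hc2]
  have : c ^ (s - 1) ≤ x ^ (s - 1) :=
    Real.rpow_le_rpow (by linarith [hc.1]) hc.2.le (by linarith)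
  gcongr

theorem sg_N_lip_aux {s M : ℝ} (hs : 0 < s) (z w : ℂ) (hz : ‖z‖ ≤ M) (hzw : ‖w‖ ≤ ‖z‖) :
    ‖(‖z‖ ^ s) • z - (‖w‖ ^ s) • w‖ ≤ (s + 2) * M ^ s * ‖z - w‖ := by
  have h0 : (‖z‖ ^ s) • z - (‖w‖ ^ s) • w = (‖z‖ ^ s) • (z - w) + (‖z‖ ^ s - ‖w‖ ^ s) • w := by
    rw [smul_sub, sub_smul]; abel
  have hzs : ‖z‖ ^ s ≤ M ^ s := Real.rpow_le_rpow (norm_nonneg _) hz hs.le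
  have h1 : ‖w‖ ^ s ≤ ‖z‖ ^ s := Real.rpow_le_rpow (norm_nonneg _) hzw hs.le
  have h2 : (‖z‖ ^ s - ‖w‖ ^ s) * ‖w‖ ≤ (s + 1) * M ^ s * ‖z - w‖ := by
    have e1 := sg_rpow_sub_le (s := s + 1) (by linarith) (norm_nonneg w) hzw
    rw [Real.rpow_add_one' (norm_nonneg _) (by linarith),
      Real.rpow_add_one' (norm_nonneg _) (by linarith), add_sub_cancel_right] at e1
    have e2 : ‖z‖ - ‖w‖ ≤ ‖z - w‖ := norm_sub_norm_le _ _
    have e3 : 0 ≤ ‖z‖ ^ s := by positivity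
    calc (‖z‖ ^ s - ‖w‖ ^ s) * ‖w‖ ≤ ‖z‖ ^ s * ‖z‖ - ‖w‖ ^ s * ‖w‖ := by nlinarith
      _ ≤ _ := e1
      _ ≤ _ := by
        have : 0 ≤ M ^ s := e3.trans hzs
        gcongr
  rw [h0]
  calc _ ≤ ‖(‖z‖ ^ s) • (z - w)‖ + ‖(‖z‖ ^ s - ‖w‖ ^ s) • w‖ := norm_add_le _ _
    _ = ‖z‖ ^ s * ‖z - w‖ + (‖z‖ ^ s - ‖w‖ ^ s) * ‖w‖ := by
      rw [norm_smul, norm_smul, Real.norm_of_nonneg (by positivity),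
        Real.norm_of_nonneg (by linarith)]
    _ ≤ M ^ s * ‖z - w‖ + (s + 1) * M ^ s * ‖z - w‖ := by gcongr
    _ = _ := by ring

theorem sg_N_lip {s M : ℝ} (hs : 0 < s) (z w : ℂ) (hz : ‖z‖ ≤ M) (hw : ‖w‖ ≤ M) :
    ‖(‖z‖ ^ s) • z - (‖w‖ ^ s) • w‖ ≤ (s + 2) * M ^ s * ‖z - w‖ := by
  rcases le_total ‖w‖ ‖z‖ with h | h
  · exact sg_N_lip_aux hs z w hz h
  · rw [norm_sub_rev, norm_sub_rev z]; exact sg_N_lip_aux hs w z hw h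

theorem sg_four {q M : ℝ} (hq : 2 < q) (b b' e e' : ℂ) (hb : ‖b‖ ≤ M) (hb' : ‖b'‖ ≤ M)
    (he : ‖e‖ ≤ M) (he' : ‖e'‖ ≤ M) :
    |(‖b + e‖ ^ q - ‖b‖ ^ q) - (‖b' + e'‖ ^ q - ‖b'‖ ^ q)| ≤
      q * q * (2 * M) ^ (q - 2) * ((‖b‖ + ‖b'‖ + ‖e‖ + ‖e'‖) * ‖e - e'‖ +
        (‖e‖ + ‖e'‖) * ‖b - b'‖) := by
  have hM : 0 ≤ M := (norm_nonneg _).trans hb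
  set bt : ℝ → ℂ := fun τ => b' + τ • (b - b') with hbt
  set et : ℝ → ℂ := fun τ => e' + τ • (e - e') with het
  have dbt : ∀ τ, HasDerivAt bt (b - b') τ := fun τ => by
    have := ((hasDerivAt_id τ).smul_const (b - b')).const_add b'
    rw [one_smul] at this
    exact this
  have det : ∀ τ, HasDerivAt et (e - e') τ := fun τ => by
    have := ((hasDerivAt_id τ).smul_const (e - e')).const_add e'
    rw [one_smul] at this
    exact this
  have key : ∀ (g : ℝ → ℂ) (g' : ℂ) (τ : ℝ), HasDerivAt g g' τ →
      HasDerivAt (fun τ => ‖g τ‖ ^ q) (q * inner ℝ ((‖g τ‖ ^ (q - 2)) • g τ) g') τ := by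
    intro g g' τ hg
    have := (hasFDerivAt_norm_rpow (g τ) (p := q) (by linarith)).comp_hasDerivAt τ hg
    convert! this using 1
    simp
    ring
  have dφ : ∀ τ, HasDerivAt (fun τ => ‖bt τ + et τ‖ ^ q - ‖bt τ‖ ^ q)
      (q * inner ℝ ((‖bt τ + et τ‖ ^ (q - 2)) • (bt τ + et τ)) ((b - b') + (e - e')) -
        q * inner ℝ ((‖bt τ‖ ^ (q - 2)) • bt τ) (b - b')) τ := fun τ =>
    (key _ _ τ ((dbt τ).add (det τ))).sub (key _ _ τ (dbt τ))
  obtain ⟨τ, hτ, hτ2⟩ := exists_hasDerivAt_eq_slope _ _ (zero_lt_one (α := ℝ))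
    (fun τ _ => (dφ τ).continuousAt.continuousWithinAt) (fun τ _ => dφ τ)
  have h0 : bt 0 = b' := by simp [hbt]
  have h1 : bt 1 = b := by simp [hbt]
  have h2 : et 0 = e' := by simp [het]
  have h3 : et 1 = e := by simp [het]
  rw [h0, h1, h2, h3, sub_zero, div_one] at hτ2
  rw [← hτ2]
  have conv : ∀ u v : ℂ, ‖v + τ • (u - v)‖ ≤ (1 - τ) * ‖v‖ + τ * ‖u‖ := by
    intro u v
    have : v + τ • (u - v) = (1 - τ) • v + τ • u := by
      rw [sub_smul, smul_sub, one_smul]; abel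
    rw [this]
    refine (norm_add_le _ _).trans ?_
    rw [norm_smul, norm_smul, Real.norm_of_nonneg (by linarith [hτ.2]),
      Real.norm_of_nonneg hτ.1.le]
  have nb : ‖bt τ‖ ≤ M := (conv b b').trans (by nlinarith [hτ.1, hτ.2])
  have ne : ‖et τ‖ ≤ M := (conv e e').trans (by nlinarith [hτ.1, hτ.2])
  have nb2 : ‖bt τ‖ ≤ ‖b‖ + ‖b'‖ := (conv b b').trans (by nlinarith [hτ.1, hτ.2, norm_nonneg b, norm_nonneg b'])
  have ne2 : ‖et τ‖ ≤ ‖e‖ + ‖e'‖ := (conv e e').trans (by nlinarith [hτ.1, hτ.2, norm_nonneg e, norm_nonneg e'])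
  have nbe : ‖bt τ + et τ‖ ≤ 2 * M := (norm_add_le _ _).trans (by linarith)
  have hlip := sg_N_lip (s := q - 2) (M := 2 * M) (by linarith) (bt τ + et τ) (bt τ) nbe (by linarith)
  rw [add_sub_cancel_left] at hlip
  set P := (2 * M) ^ (q - 2) with hP
  have hP0 : 0 ≤ P := by positivity
  set Z := (‖bt τ + et τ‖ ^ (q - 2)) • (bt τ + et τ)
  set W := (‖bt τ‖ ^ (q - 2)) • bt τ
  have hZ : ‖Z‖ ≤ P * (‖b‖ + ‖b'‖ + ‖e‖ + ‖e'‖) := by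
    simp only [Z]
    rw [norm_smul, Real.norm_of_nonneg (by positivity)]
    have : ‖bt τ + et τ‖ ^ (q - 2) ≤ P := Real.rpow_le_rpow (norm_nonneg _) nbe (by linarith)
    have h5 : ‖bt τ + et τ‖ ≤ ‖b‖ + ‖b'‖ + ‖e‖ + ‖e'‖ := (norm_add_le _ _).trans (by linarith)
    gcongr
  have e1 : q * inner ℝ Z ((b - b') + (e - e')) - q * inner ℝ W (b - b') =
      q * (inner ℝ Z (e - e') + inner ℝ (Z - W) (b - b')) := by
    rw [inner_add_right, inner_sub_left]; ring
  rw [e1, abs_mul, abs_of_pos (by linarith)]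
  have e2 : |inner ℝ Z (e - e') + inner ℝ (Z - W) (b - b')| ≤
      ‖Z‖ * ‖e - e'‖ + ‖Z - W‖ * ‖b - b'‖ :=
    (abs_add_le _ _).trans (add_le_add (abs_real_inner_le_norm _ _) (abs_real_inner_le_norm _ _))
  have e3 : ‖Z - W‖ ≤ q * P * (‖e‖ + ‖e'‖) := by
    refine hlip.trans ?_
    rw [sub_add_cancel]
    gcongr
  calc _ ≤ q * (‖Z‖ * ‖e - e'‖ + ‖Z - W‖ * ‖b - b'‖) := by gcongr
    _ ≤ q * ((q * P * (‖b‖ + ‖b'‖ + ‖e‖ + ‖e'‖)) * ‖e - e'‖ + (q * P * (‖e‖ + ‖e'‖)) * ‖b - b'‖) := by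
      gcongr
      refine hZ.trans ?_
      have : 0 ≤ P * (‖b‖ + ‖b'‖ + ‖e‖ + ‖e'‖) := by positivity
      nlinarith
    _ = _ := by ring


theorem sg_B {ι : Type*} [Fintype ι] [DecidableEq ι] {θ : ℝ} (h0 : 0 < θ) (h1 : θ ≤ 1)
    (A : ι → ℝ) (hA : ∀ i, 0 < A i) (i : ι) :
    |A i * (∑ j, A j) ^ (θ - 1) - A i ^ θ| ≤
      ∑ j ∈ Finset.univ.erase i, (A i * A j) ^ (θ / 2) := by
  set S := ∑ j, A j with hS
  have hSi : S = A i + ∑ j ∈ Finset.univ.erase i, A j :=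
    (Finset.add_sum_erase _ _ (Finset.mem_univ i)).symm
  have ha := hA i
  have haS : A i ≤ S := by
    rw [hSi]; linarith [Finset.sum_nonneg (fun j (_ : j ∈ Finset.univ.erase i) => (hA j).le)]
  have hSp : 0 < S := ha.trans_le haS
  have e1 : A i ^ θ = A i * A i ^ (θ - 1) := by
    rw [Real.rpow_sub_one ha.ne']; field_simp
  have e2 : S ^ (θ - 1) ≤ A i ^ (θ - 1) := Real.rpow_le_rpow_of_nonpos ha haS (by linarith)
  rw [abs_sub_comm, abs_of_nonneg (by rw [e1]; nlinarith)]
  have e3 : A i * S ^ (θ - 1) = A i ^ θ * (A i / S) ^ (1 - θ) := by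
    rw [Real.div_rpow ha.le hSp.le, show (1 - θ) = -(θ - 1) by ring, Real.rpow_neg ha.le,
      Real.rpow_neg hSp.le, e1]
    have : A i ^ (θ - 1) ≠ 0 := (Real.rpow_pos_of_pos ha _).ne'
    field_simp
  have hr : A i / S ≤ 1 := (div_le_one hSp).2 haS
  have e4 : A i / S ≤ (A i / S) ^ (1 - θ) := by
    have := Real.rpow_le_rpow_of_exponent_ge (by positivity) hr (by linarith : 1 - θ ≤ 1)
    simpa using this
  have e5 : 1 - A i / S = ∑ j ∈ Finset.univ.erase i, A j / S := by
    rw [← Finset.sum_div]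
    rw [eq_div_iff hSp.ne', sub_mul, div_mul_cancel₀ _ hSp.ne']; linarith
  have hpos : 0 < A i ^ θ := Real.rpow_pos_of_pos ha _
  calc A i ^ θ - A i * S ^ (θ - 1) ≤ A i ^ θ * (1 - A i / S) := by rw [e3]; nlinarith
    _ = ∑ j ∈ Finset.univ.erase i, A i ^ θ * (A j / S) := by rw [e5, Finset.mul_sum]
    _ ≤ _ := by
      apply Finset.sum_le_sum
      intro j hj
      have hj0 := hA j
      have hjS : A j ≤ S := Finset.single_le_sum (f := A) (fun k _ => (hA k).le) (Finset.mem_univ j)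
      have f1 : A j / S ≤ (A j / S) ^ (θ / 2) := by
        have := Real.rpow_le_rpow_of_exponent_ge (by positivity) ((div_le_one hSp).2 hjS)
          (by linarith : θ / 2 ≤ 1)
        simpa using this
      have f2 : (A j / S) ^ (θ / 2) ≤ (A j / A i) ^ (θ / 2) := by
        apply Real.rpow_le_rpow (by positivity) _ (by linarith)
        gcongr
      have f3 : A i ^ θ * (A j / A i) ^ (θ / 2) = (A i * A j) ^ (θ / 2) := by
        rw [Real.div_rpow hj0.le ha.le, Real.mul_rpow ha.le hj0.le]
        have : A i ^ θ = A i ^ (θ / 2) * A i ^ (θ / 2) := by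
          rw [← Real.rpow_add ha]; ring_nf
        rw [this]
        have : A i ^ (θ / 2) ≠ 0 := (Real.rpow_pos_of_pos ha _).ne'
        field_simp
      rw [← f3]
      gcongr
      exact f1.trans f2

theorem sg_quad {V : Type*} [NormedAddCommGroup V] [InnerProductSpace ℝ V] (x e : V) (he : ‖e‖ = 1)
    (t a b N : ℝ) (hN : 1 ≤ N) (ha : |a| ≤ N) (hab : 4 ≤ |a - b|) :
    2 * ((1 / (8 * N ^ 2)) * ‖x‖ ^ 2 + t ^ 2) ≤ ‖x - t • (a • e)‖ ^ 2 + ‖x - t • (b • e)‖ ^ 2 := by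
  set y := x - t • (a • e) with hy
  set z := x - t • (b • e) with hz
  have h1 : ‖y - z‖ = |t| * |a - b| := by
    have : y - z = (t * (b - a)) • e := by
      simp only [hy, hz, smul_smul, mul_sub, sub_smul]; abel
    rw [this, norm_smul, he, mul_one, Real.norm_eq_abs, abs_mul, abs_sub_comm b a]
  have h2 : (4 * |t|) ^ 2 ≤ ‖y - z‖ ^ 2 := by
    rw [h1, mul_comm 4]; gcongr
  have h3 : ‖y - z‖ ^ 2 ≤ 2 * (‖y‖ ^ 2 + ‖z‖ ^ 2) := by
    have := norm_sub_le y z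
    nlinarith [sq_nonneg (‖y‖ - ‖z‖), norm_nonneg (y - z)]
  have h4 : ‖x‖ ^ 2 ≤ 2 * ‖y‖ ^ 2 + 2 * (t ^ 2 * N ^ 2) := by
    have e1 : ‖x‖ ≤ ‖y‖ + |t| * N := by
      have : x = y + t • (a • e) := by rw [hy]; abel
      calc ‖x‖ ≤ ‖y‖ + ‖t • (a • e)‖ := by
            conv_lhs => rw [this]
            exact norm_add_le _ _
        _ ≤ _ := by
          rw [norm_smul, norm_smul, he, mul_one, Real.norm_eq_abs, Real.norm_eq_abs]; gcongr
    have : t ^ 2 * N ^ 2 = (|t| * N) ^ 2 := by rw [mul_pow, sq_abs]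
    rw [this]
    nlinarith [sq_nonneg (‖y‖ - |t| * N), norm_nonneg x, norm_nonneg y]
  rw [mul_pow, sq_abs] at h2
  have hN2 : 1 ≤ N ^ 2 := by nlinarith
  have h5 : (1 / (8 * N ^ 2)) * ‖x‖ ^ 2 ≤ (1 / 4) * ‖y‖ ^ 2 + (1 / 4) * t ^ 2 := by
    calc (1 / (8 * N ^ 2)) * ‖x‖ ^ 2 ≤ (1 / (8 * N ^ 2)) * (2 * ‖y‖ ^ 2 + 2 * (t ^ 2 * N ^ 2)) := by gcongr
      _ = (1 / 4) * (‖y‖ ^ 2 / N ^ 2) + (1 / 4) * t ^ 2 := by field_simp; ring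
      _ ≤ _ := by gcongr; exact div_le_self (by positivity) hN2
  nlinarith [sq_nonneg t, sq_nonneg ‖z‖]

theorem sg_lin_exp {c : ℝ} (hc : 0 < c) (y : ℝ) : y ≤ (1 + 1 / c) * Real.exp (c * y ^ 2) := by
  have h1 : c * y ^ 2 + 1 ≤ Real.exp (c * y ^ 2) := Real.add_one_le_exp _
  have h2 : 1 ≤ Real.exp (c * y ^ 2) := Real.one_le_exp (by positivity)
  have h3 : y ^ 2 ≤ (1 / c) * Real.exp (c * y ^ 2) := by
    rw [div_mul_eq_mul_div, le_div_iff₀ hc]; linarith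
  nlinarith [sq_nonneg (y - 1)]

noncomputable def sgS {V ι : Type*} [NormedAddCommGroup V] [InnerProductSpace ℝ V] [Fintype ι]
    (w N : ι → ℝ) (e : V) (p t : ℝ) (x : V) : ℝ :=
  ∑ i, w i ^ p * Real.exp (-π * ‖x - t • (N i • e)‖ ^ 2)

noncomputable def sgG {V ι : Type*} [NormedAddCommGroup V] [InnerProductSpace ℝ V] [Fintype ι]
    (w N : ι → ℝ) (e : V) (p t : ℝ) (x : V) : ℝ :=
  ∑ i, w i * Real.exp (-(π / p) * ‖x - t • (N i • e)‖ ^ 2)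

theorem sg_E {V ι : Type*} [NormedAddCommGroup V] [InnerProductSpace ℝ V] [Fintype ι] [Nonempty ι]
    (w N : ι → ℝ) (e : V) (p : ℝ) (hp : 1 ≤ p) (he : ‖e‖ = 1) (hw : ∀ i, 0 < w i)
    (hw1 : ∀ i, w i ≤ 1) (hN : ∀ i j, i ≠ j → 4 ≤ |N i - N j|) :
    ∃ κ > 0, ∃ C > 0, ∀ t s : ℝ, 0 ≤ t → t ≤ s → ∀ x : V,
      |sgS w N e p t x ^ (1 / p) - sgG w N e p t x| ≤
        C * Real.exp (-(π / (2 * p)) * t ^ 2) * Real.exp (-κ * ‖x‖ ^ 2) ∧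
      |(sgS w N e p s x ^ (1 / p) - sgG w N e p s x) -
        (sgS w N e p t x ^ (1 / p) - sgG w N e p t x)| ≤
        C * (s - t) * Real.exp (-(π / (2 * p)) * t ^ 2) * Real.exp (-κ * ‖x‖ ^ 2) := by
  classical
  obtain ⟨M, hM1, hM⟩ : ∃ M : ℝ, 1 ≤ M ∧ ∀ i, |N i| ≤ M := by
    refine ⟨1 + ∑ i, |N i|, ?_, fun i => ?_⟩
    · linarith [Finset.sum_nonneg (fun i (_ : i ∈ Finset.univ) => abs_nonneg (N i))]
    · linarith [Finset.single_le_sum (f := fun i => |N i|) (fun k _ => abs_nonneg _) (Finset.mem_univ i)]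
  have hp0 : 0 < p := by linarith
  set θ := 1 / p with hθ
  have hθ0 : 0 < θ := by positivity
  have hθ1 : θ ≤ 1 := by rw [hθ, div_le_one hp0]; exact hp
  have hπp : π / p = π * θ := by rw [hθ]; ring
  have hπp2 : π / (2 * p) = π * θ / 2 := by rw [hθ]; field_simp
  set η := 1 / (8 * M ^ 2) with hη
  have hη0 : 0 < η := by positivity
  set A : ℝ → V → ι → ℝ := fun t x i => w i ^ p * Real.exp (-π * ‖x - t • (N i • e)‖ ^ 2) with hA
  have hApos : ∀ t x i, 0 < A t x i := fun t x i =>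
    mul_pos (Real.rpow_pos_of_pos (hw i) _) (Real.exp_pos _)
  have hAθ : ∀ t x i, A t x i ^ θ = w i * Real.exp (-(π / p) * ‖x - t • (N i • e)‖ ^ 2) := by
    intro t x i
    simp only [hA]
    rw [Real.mul_rpow (Real.rpow_pos_of_pos (hw i) _).le (Real.exp_pos _).le,
      ← Real.rpow_mul (hw i).le, hθ, mul_one_div_cancel hp0.ne', Real.rpow_one, ← Real.exp_mul]
    congr 2; ring
  set n : ℝ := (Fintype.card ι : ℝ) with hn
  have hn1 : 1 ≤ n := by rw [hn]; exact_mod_cast Fintype.card_pos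
  have hB : ∀ t x i, |A t x i * (∑ j, A t x j) ^ (θ - 1) - A t x i ^ θ| ≤
      n * Real.exp (-(π * θ) * (η * ‖x‖ ^ 2 + t ^ 2)) := by
    intro t x i
    refine (sg_B hθ0 hθ1 (A t x) (hApos t x) i).trans ?_
    calc _ ≤ ∑ j ∈ Finset.univ.erase i, Real.exp (-(π * θ) * (η * ‖x‖ ^ 2 + t ^ 2)) := by
          apply Finset.sum_le_sum
          intro j hj
          have hij : i ≠ j := (Finset.ne_of_mem_erase hj).symm
          have hq := sg_quad x e he t (N i) (N j) M hM1 (hM i) (hN i j hij)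
          have hle : A t x i * A t x j ≤ Real.exp (-π * (‖x - t • (N i • e)‖ ^ 2 + ‖x - t • (N j • e)‖ ^ 2)) := by
            simp only [hA]
            have g1 : w i ^ p ≤ 1 := Real.rpow_le_one (hw i).le (hw1 i) hp0.le
            have g2 : w j ^ p ≤ 1 := Real.rpow_le_one (hw j).le (hw1 j) hp0.le
            have g3 : 0 < w j ^ p := Real.rpow_pos_of_pos (hw j) _
            rw [mul_add, Real.exp_add, mul_mul_mul_comm]
            apply mul_le_of_le_one_left (by positivity)
            exact mul_le_one₀ g1 g3.le g2
          calc (A t x i * A t x j) ^ (θ / 2) ≤ (Real.exp (-π * (‖x - t • (N i • e)‖ ^ 2 + ‖x - t • (N j • e)‖ ^ 2))) ^ (θ / 2) :=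
                Real.rpow_le_rpow (mul_pos (hApos _ _ _) (hApos _ _ _)).le hle (by positivity)
            _ = Real.exp (-(π * (θ / 2)) * (‖x - t • (N i • e)‖ ^ 2 + ‖x - t • (N j • e)‖ ^ 2)) := by
                rw [← Real.exp_mul]; ring_nf
            _ ≤ _ := by
                apply Real.exp_le_exp.2
                have := mul_le_mul_of_nonneg_left hq (by positivity : 0 ≤ π * (θ / 2))
                linarith
      _ ≤ _ := by
          rw [Finset.sum_const, nsmul_eq_mul]
          gcongr
          rw [hn]
          exact_mod_cast Finset.card_le_univ _
  -- value
  have hval : ∀ t x, sgS w N e p t x ^ θ - sgG w N e p t x =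
      ∑ i, (A t x i * (∑ j, A t x j) ^ (θ - 1) - A t x i ^ θ) := by
    intro t x
    rw [Finset.sum_sub_distrib, ← Finset.sum_mul]
    have hS : 0 < ∑ j, A t x j := Finset.sum_pos (fun i _ => hApos t x i) Finset.univ_nonempty
    congr 1
    · change (∑ j, A t x j) ^ θ = _
      rw [Real.rpow_sub_one hS.ne']; field_simp
    · simp only [hAθ]; rfl
  set l : ℝ → V → ι → ℝ := fun t x i => 2 * π * N i * inner ℝ (x - t • (N i • e)) e with hl
  have hdn : ∀ t x i, HasDerivAt (fun t : ℝ => ‖x - t • (N i • e)‖ ^ 2)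
      (-2 * N i * inner ℝ (x - t • (N i • e)) e) t := by
    intro t x i
    have h1 : HasDerivAt (fun t : ℝ => x - t • (N i • e)) (-(N i • e)) t := by
      have := ((hasDerivAt_id t).smul_const (N i • e)).const_sub x
      rw [one_smul] at this
      exact this
    have := h1.norm_sq
    convert this using 1
    rw [inner_neg_right, inner_smul_right]; ring
  have hdA : ∀ t x i, HasDerivAt (fun t => A t x i) (A t x i * l t x i) t := by
    intro t x i
    have := (((hdn t x i).const_mul (-π)).exp).const_mul (w i ^ p)
    convert! this using 1
    simp only [hA, hl]; ring
  have hdAθ : ∀ t x i, HasDerivAt (fun t => w i * Real.exp (-(π / p) * ‖x - t • (N i • e)‖ ^ 2))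
      (θ * (A t x i ^ θ * l t x i)) t := by
    intro t x i
    have := (((hdn t x i).const_mul (-(π / p))).exp).const_mul (w i)
    convert! this using 1
    rw [hAθ, hπp]; simp only [hl]; ring
  have hdE : ∀ t x, HasDerivAt (fun t => sgS w N e p t x ^ θ - sgG w N e p t x)
      (θ * ∑ i, (A t x i * (∑ j, A t x j) ^ (θ - 1) - A t x i ^ θ) * l t x i) t := by
    intro t x
    have hS : 0 < ∑ j, A t x j := Finset.sum_pos (fun i _ => hApos t x i) Finset.univ_nonempty
    have h1 : HasDerivAt (fun t => sgS w N e p t x) (∑ i, A t x i * l t x i) t :=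
      HasDerivAt.fun_sum (fun i _ => hdA t x i)
    have h2 : HasDerivAt (fun t => sgG w N e p t x) (∑ i, θ * (A t x i ^ θ * l t x i)) t :=
      HasDerivAt.fun_sum (fun i _ => hdAθ t x i)
    have h3 := (h1.rpow_const (p := θ) (Or.inl hS.ne')).sub h2
    convert! h3 using 1
    change _ = (∑ i, A t x i * l t x i) * θ * (∑ j, A t x j) ^ (θ - 1) - _
    rw [← Finset.mul_sum]
    simp only [sub_mul, Finset.sum_sub_distrib]
    rw [mul_sub]
    congr 1
    rw [mul_comm (∑ i, A t x i * l t x i) θ, mul_assoc, Finset.sum_mul]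
    congr 1
    exact Finset.sum_congr rfl fun i _ => by ring
  set cc := min (π * θ * η / 4) (π * θ / (4 * M ^ 2)) with hcc
  have hcc0 : 0 < cc := lt_min (by positivity) (by positivity)
  set L := 2 * π * M * (2 * (1 + 1 / cc)) with hL
  have hL0 : 0 < L := by positivity
  have hlb : ∀ t x i, 0 ≤ t → |l t x i| ≤ L * Real.exp (π * θ / 2 * (η * ‖x‖ ^ 2 + t ^ 2)) := by
    intro t x i ht
    have h1 : |inner ℝ (x - t • (N i • e)) e| ≤ ‖x‖ + t * M := by
      refine (abs_real_inner_le_norm _ _).trans ?_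
      rw [he, mul_one]
      refine (norm_sub_le _ _).trans ?_
      rw [norm_smul, norm_smul, he, mul_one, Real.norm_of_nonneg ht, Real.norm_eq_abs]
      gcongr
      exact hM i
    have h2 : ‖x‖ ≤ (1 + 1 / cc) * Real.exp (π * θ / 2 * (η * ‖x‖ ^ 2 + t ^ 2)) := by
      refine (sg_lin_exp hcc0 ‖x‖).trans ?_
      refine mul_le_mul_of_nonneg_left (Real.exp_le_exp.2 ?_) (by positivity)
      have : cc * ‖x‖ ^ 2 ≤ (π * θ * η / 4) * ‖x‖ ^ 2 := by gcongr; exact min_le_left _ _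
      have h5 : 0 ≤ π * θ * η * ‖x‖ ^ 2 := by positivity
      have h6 : 0 ≤ π * θ * t ^ 2 := by positivity
      linarith
    have h3 : t * M ≤ (1 + 1 / cc) * Real.exp (π * θ / 2 * (η * ‖x‖ ^ 2 + t ^ 2)) := by
      refine (sg_lin_exp hcc0 (t * M)).trans ?_
      refine mul_le_mul_of_nonneg_left (Real.exp_le_exp.2 ?_) (by positivity)
      have : cc * (t * M) ^ 2 ≤ (π * θ / (4 * M ^ 2)) * (t * M) ^ 2 := by gcongr; exact min_le_right _ _
      have h4 : (π * θ / (4 * M ^ 2)) * (t * M) ^ 2 = π * θ / 4 * t ^ 2 := by field_simp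
      have h5 : 0 ≤ π * θ * η * ‖x‖ ^ 2 := by positivity
      have h6 : 0 ≤ π * θ * t ^ 2 := by positivity
      linarith
    simp only [hl]
    rw [abs_mul, abs_mul, abs_of_pos (by positivity : 0 < 2 * π)]
    calc 2 * π * |N i| * |inner ℝ (x - t • (N i • e)) e| ≤ 2 * π * M * (‖x‖ + t * M) := by
          gcongr; exact hM i
      _ ≤ 2 * π * M * ((1 + 1 / cc) * Real.exp (π * θ / 2 * (η * ‖x‖ ^ 2 + t ^ 2)) + (1 + 1 / cc) * Real.exp (π * θ / 2 * (η * ‖x‖ ^ 2 + t ^ 2))) := by gcongr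
      _ = _ := by rw [hL]; ring
  have hdEb : ∀ t x, 0 ≤ t → |θ * ∑ i, (A t x i * (∑ j, A t x j) ^ (θ - 1) - A t x i ^ θ) * l t x i| ≤
      n * n * L * Real.exp (-(π * θ / 2) * (η * ‖x‖ ^ 2 + t ^ 2)) := by
    intro t x ht
    rw [abs_mul, abs_of_pos hθ0]
    have h1 : |∑ i, (A t x i * (∑ j, A t x j) ^ (θ - 1) - A t x i ^ θ) * l t x i| ≤
        ∑ i : ι, n * L * Real.exp (-(π * θ / 2) * (η * ‖x‖ ^ 2 + t ^ 2)) := by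
      refine (Finset.abs_sum_le_sum_abs _ _).trans (Finset.sum_le_sum fun i _ => ?_)
      rw [abs_mul]
      calc _ ≤ (n * Real.exp (-(π * θ) * (η * ‖x‖ ^ 2 + t ^ 2))) * (L * Real.exp (π * θ / 2 * (η * ‖x‖ ^ 2 + t ^ 2))) :=
            mul_le_mul (hB t x i) (hlb t x i ht) (abs_nonneg _) (by positivity)
        _ = n * L * (Real.exp (-(π * θ) * (η * ‖x‖ ^ 2 + t ^ 2)) * Real.exp (π * θ / 2 * (η * ‖x‖ ^ 2 + t ^ 2))) := by ring
        _ = _ := by rw [← Real.exp_add]; ring_nf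
    rw [Finset.sum_const, nsmul_eq_mul, Finset.card_univ] at h1
    calc _ ≤ 1 * (n * (n * L * Real.exp (-(π * θ / 2) * (η * ‖x‖ ^ 2 + t ^ 2)))) := by gcongr
      _ = _ := by ring
  have hexp : ∀ t (x : V), Real.exp (-(π * θ / 2) * (η * ‖x‖ ^ 2 + t ^ 2)) =
      Real.exp (-(π / (2 * p)) * t ^ 2) * Real.exp (-(π * θ / 2 * η) * ‖x‖ ^ 2) := by
    intro t x; rw [← Real.exp_add, hπp2]; ring_nf
  refine ⟨π * θ / 2 * η, by positivity, n * n * L + n * n, by positivity, fun t s ht hts x => ⟨?_, ?_⟩⟩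
  · rw [hval, mul_assoc, ← hexp]
    calc _ ≤ ∑ i : ι, n * Real.exp (-(π * θ) * (η * ‖x‖ ^ 2 + t ^ 2)) :=
          (Finset.abs_sum_le_sum_abs _ _).trans (Finset.sum_le_sum fun i _ => hB t x i)
      _ = n * n * Real.exp (-(π * θ) * (η * ‖x‖ ^ 2 + t ^ 2)) := by
          rw [Finset.sum_const, nsmul_eq_mul, Finset.card_univ]; ring
      _ ≤ _ := by
          have : 0 ≤ n * n * L := by positivity
          gcongr
          · linarith
          · linarith [mul_pos Real.pi_pos hθ0]
  · rw [mul_assoc, ← hexp]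
    have := (convex_Icc t s).norm_image_sub_le_of_norm_hasDerivWithin_le (C := n * n * L * Real.exp (-(π * θ / 2) * (η * ‖x‖ ^ 2 + t ^ 2)))
      (fun τ _ => (hdE τ x).hasDerivWithinAt) (fun τ hτ => by
        rw [Real.norm_eq_abs]
        refine (hdEb τ x (ht.trans hτ.1)).trans ?_
        have : t ^ 2 ≤ τ ^ 2 := pow_le_pow_left₀ ht hτ.1 2
        refine mul_le_mul_of_nonneg_left (Real.exp_le_exp.2 ?_) (by positivity)
        have h7 := mul_pos Real.pi_pos hθ0
        nlinarith) (Set.left_mem_Icc.2 hts) (Set.right_mem_Icc.2 hts)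
    rw [Real.norm_eq_abs, Real.norm_eq_abs, abs_of_nonneg (by linarith : 0 ≤ s - t)] at this
    refine this.trans ?_
    have h8 : 0 ≤ n * n * (s - t) * Real.exp (-(π * θ / 2) * (η * ‖x‖ ^ 2 + t ^ 2)) := by
      have : 0 ≤ s - t := by linarith
      positivity
    nlinarith


theorem sg_binom (a : ℝ) (x : ℂ) (hx : ‖x‖ < 1) :
    HasSum (fun j : ℕ => ((Ring.choose a j : ℝ) : ℂ) * x ^ j) ((1 + x) ^ (a : ℂ)) := by
  have hx' : ‖x‖ₑ < 1 := by
    rw [← ofReal_norm_eq_enorm]; exact ENNReal.ofReal_lt_one.2 hx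
  have h := (Complex.one_add_cpow_hasFPowerSeriesOnBall_zero (a := (a : ℂ))).hasSum (y := x)
    (by simpa using hx')
  simp only [zero_add] at h
  refine h.congr_fun ?_
  intro j
  rw [binomialSeries_apply]
  simp [List.ofFn_const, Complex.ofReal_choose]

theorem sg_binom_summable (a : ℝ) {r : ℝ} (hr0 : 0 ≤ r) (hr : r < 1) :
    Summable (fun j : ℕ => ‖Ring.choose a j * r ^ j‖) := by
  have := (sg_binom a (r : ℂ) (by simpa [abs_of_nonneg hr0] using hr)).summable.norm
  refine this.congr fun j => ?_
  rw [norm_mul, norm_mul, Complex.norm_real, norm_pow, norm_pow, Complex.norm_real]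

theorem sg_choose_rec (a : ℝ) (n : ℕ) :
    Ring.choose a (n + 1) * (n + 1) = Ring.choose a n * (a - n) := by
  have h1 := Ring.choose_smul_choose a (n := n + 1) (k := n) (by omega)
  simp only [Nat.choose_succ_self_right, nsmul_eq_mul, add_tsub_cancel_left, Ring.choose_one_right] at h1
  push_cast at h1
  linarith

theorem sg_choose_neg (a : ℝ) (ha : ∀ k : ℕ, a ≠ k) : ∃ J : ℕ, Ring.choose a J < 0 := by
  by_contra! hcon
  have hne : ∀ n, Ring.choose a n ≠ 0 := by
    intro n
    induction n with
    | zero => simp [Ring.choose_zero_right]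
    | succ n ih =>
      intro h
      have := sg_choose_rec a n
      rw [h, zero_mul] at this
      rcases mul_eq_zero.1 this.symm with h | h
      · exact ih h
      · exact ha n (by linarith)
  obtain ⟨n, hn⟩ := exists_nat_gt a
  have h1 := sg_choose_rec a n
  have h2 := (hcon n).lt_of_ne' (hne n)
  have h3 := (hcon (n + 1)).lt_of_ne' (hne (n + 1))
  have h4 : 0 < Ring.choose a (n + 1) * (n + 1) := by positivity
  nlinarith

/-- pairs of naturals as (difference, minimum) -/
def sgEquiv : ℤ × ℕ ≃ ℕ × ℕ where
  toFun z := (z.2 + z.1.toNat, z.2 + (-z.1).toNat)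
  invFun p := ((p.1 : ℤ) - p.2, min p.1 p.2)
  left_inv z := by ext <;> simp <;> omega
  right_inv p := by ext <;> simp <;> omega

noncomputable def sgCoef (a r : ℝ) (k : ℤ) : ℝ :=
  ∑' j : ℕ, (Ring.choose a (j + k.toNat) * r ^ (j + k.toNat)) *
    (Ring.choose a (j + (-k).toNat) * r ^ (j + (-k).toNat))

theorem sg_fam_summable (a : ℝ) {r : ℝ} (hr0 : 0 ≤ r) (hr : r < 1) :
    Summable (fun z : ℤ × ℕ => (Ring.choose a (z.2 + z.1.toNat) * r ^ (z.2 + z.1.toNat)) *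
    (Ring.choose a (z.2 + (-z.1).toNat) * r ^ (z.2 + (-z.1).toNat))) := by
  have h := sg_binom_summable a hr0 hr
  have h2 := (summable_mul_of_summable_norm h h)
  exact (sgEquiv.summable_iff (f := fun p : ℕ × ℕ => (Ring.choose a p.1 * r ^ p.1) *
    (Ring.choose a p.2 * r ^ p.2))).2 h2

theorem sg_coef_summable (a : ℝ) {r : ℝ} (hr0 : 0 ≤ r) (hr : r < 1) :
    Summable (fun k => |sgCoef a r k|) := (sg_fam_summable a hr0 hr).prod.abs

theorem sg_coef_term (c : ℕ → ℝ) {r : ℝ} (z : ℂ) (hz : ‖z‖ = 1) (k : ℤ) (j : ℕ) :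
    ((c (j + k.toNat) : ℂ) * (r * z) ^ (j + k.toNat)) *
      (starRingEnd ℂ) ((c (j + (-k).toNat) : ℂ) * (r * z) ^ (j + (-k).toNat)) =
    (((c (j + k.toNat) * r ^ (j + k.toNat)) *
    (c (j + (-k).toNat) * r ^ (j + (-k).toNat)) : ℝ) : ℂ) * z ^ k := by
  have hz0 : z ≠ 0 := by intro h; simp [h] at hz
  have hc : (starRingEnd ℂ) z = z⁻¹ := by
    rw [Complex.inv_def, Complex.normSq_eq_norm_sq, hz]; simp
  simp only [map_mul, map_pow, Complex.conj_ofReal, hc]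
  have hk : z ^ k = z ^ (j + k.toNat) * (z⁻¹) ^ (j + (-k).toNat) := by
    rw [← zpow_natCast, ← zpow_natCast, inv_zpow', ← zpow_add₀ hz0]
    congr 1; push_cast; omega
  rw [hk]
  push_cast
  rw [mul_pow, mul_pow]
  ring

theorem sg_conj_mul (f g : ℕ → ℂ) (W V : ℂ) (h : HasSum f W) (h2 : HasSum g V) :
    HasSum (fun y : ℕ × ℕ => f y.1 * g y.2) (W * V) := by
  have hs := summable_mul_of_summable_norm (f := f) (g := g) h.summable.norm h2.summable.norm
  exact h.mul h2 hs

theorem sg_coef_hasSum {q r : ℝ} (hr0 : 0 ≤ r) (hr : r < 1) (z : ℂ) (hz : ‖z‖ = 1) :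
    HasSum (fun k : ℤ => (sgCoef (q / 2) r k : ℂ) * z ^ k) ((‖1 + r * z‖ ^ q : ℝ) : ℂ) := by
  have hrz : ‖(r : ℂ) * z‖ < 1 := by simpa [hz, abs_of_nonneg hr0] using hr
  have h1 := sg_binom (q / 2) (r * z) hrz
  have e1 : (1 + (r : ℂ) * z) ^ ((q / 2 : ℝ) : ℂ) *
      (starRingEnd ℂ) ((1 + (r : ℂ) * z) ^ ((q / 2 : ℝ) : ℂ)) =
      ((‖1 + r * z‖ ^ q : ℝ) : ℂ) := by
    rw [Complex.mul_conj, Complex.normSq_eq_norm_sq, Complex.norm_cpow_real,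
      ← Real.rpow_mul_natCast (norm_nonneg _)]
    congr 2; push_cast; ring
  have hfam := sg_fam_summable (q / 2) hr0 hr
  have hdef : ∀ k, sgCoef (q / 2) r k = ∑' j : ℕ, (Ring.choose (q / 2) (j + k.toNat) * r ^ (j + k.toNat)) *
    (Ring.choose (q / 2) (j + (-k).toNat) * r ^ (j + (-k).toNat)) := fun k => rfl
  generalize sgCoef (q / 2) r = A at *
  generalize (1 + (r : ℂ) * z) ^ ((q / 2 : ℝ) : ℂ) = W at *
  generalize hcdef : (fun j : ℕ => Ring.choose (q / 2) j) = c at *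
  have hcj : ∀ j, Ring.choose (q / 2) j = c j := fun j => by rw [← hcdef]
  simp only [hcj] at *
  clear hcj hcdef
  obtain ⟨g, hg⟩ : ∃ g : ℕ → ℂ, g = fun j => (starRingEnd ℂ) ((c j : ℂ) * (r * z) ^ j) := ⟨_, rfl⟩
  obtain ⟨V, hV⟩ : ∃ V : ℂ, V = (starRingEnd ℂ) W := ⟨_, rfl⟩
  have h2 : HasSum g V := by
    rw [hg, hV]; exact Complex.hasSum_conj'.2 h1
  have h3 := sg_conj_mul (fun j => (c j : ℂ) * (r * z) ^ j) g _ V h1 h2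
  rw [hV] at h3
  rw [e1] at h3
  have h4 : HasSum (fun y : ℤ × ℕ => (((c (y.2 + y.1.toNat) * r ^ (y.2 + y.1.toNat)) *
    (c (y.2 + (-y.1).toNat) * r ^ (y.2 + (-y.1).toNat)) : ℝ) : ℂ) * z ^ y.1)
      ((‖1 + r * z‖ ^ q : ℝ) : ℂ) := by
    refine HasSum.congr_fun (f := (fun y : ℕ × ℕ => (c y.1 : ℂ) * (r * z) ^ y.1 * g y.2) ∘ sgEquiv) ((sgEquiv.hasSum_iff).2 h3) ?_
    intro y
    have := (sg_coef_term (r := r) c z hz y.1 y.2).symm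
    simp only [Function.comp, hg]
    exact this
  have h5 : ∀ k : ℤ, HasSum (fun j : ℕ => (((c (j + k.toNat) * r ^ (j + k.toNat)) *
    (c (j + (-k).toNat) * r ^ (j + (-k).toNat)) : ℝ) : ℂ) * z ^ k) ((A k : ℂ) * z ^ k) := by
    intro k
    rw [hdef k]
    have h6 : Summable (fun j : ℕ => (c (j + k.toNat) * r ^ (j + k.toNat)) *
      (c (j + (-k).toNat) * r ^ (j + (-k).toNat))) := hfam.prod_factor k
    exact HasSum.mul_right (z ^ k) (Complex.hasSum_ofReal.2 h6.hasSum)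
  exact HasSum.prod_fiberwise (g := fun k : ℤ => (A k : ℂ) * z ^ k) h4 h5

theorem sg_coef_nat {a r : ℝ} (J : ℕ) :
    sgCoef a r J = r ^ J * ∑' j : ℕ, Ring.choose a (j + J) * Ring.choose a j * r ^ (2 * j) := by
  rw [sgCoef, ← tsum_mul_left]
  congr 1; ext j
  simp only [Int.toNat_natCast, Int.toNat_neg_natCast, add_zero]
  ring

theorem sg_coef_neg {a r : ℝ} (k : ℤ) : sgCoef a r (-k) = sgCoef a r k := by
  simp only [sgCoef, neg_neg]
  congr 1; ext j; ring

theorem sg_coef_tendsto (a : ℝ) (J : ℕ) :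
    Tendsto (fun r : ℝ => ∑' j : ℕ, Ring.choose a (j + J) * Ring.choose a j * r ^ (2 * j))
      (𝓝[>] 0) (𝓝 (Ring.choose a J)) := by
  have h := sg_binom_summable a (r := 1 / 2) (by norm_num) (by norm_num)
  have h2 := (summable_mul_of_summable_norm h h).abs
  have h3 : Summable (fun j : ℕ => |Ring.choose a (j + J) * Ring.choose a j| * (1 / 2 : ℝ) ^ (2 * j)) := by
    have h4 := (h2.comp_injective (i := fun j : ℕ => (j + J, j)) (fun x y hxy => by simpa using hxy)).mul_left
      ((2 : ℝ) ^ J)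
    refine h4.congr fun j => ?_
    simp only [Function.comp, abs_mul, abs_norm, norm_mul, Real.norm_eq_abs, abs_pow]
    rw [pow_add, pow_mul', pow_two, abs_of_pos (by norm_num : (0:ℝ) < 1/2)]
    have : (2:ℝ)^J * (1/2)^J = 1 := by rw [← mul_pow]; norm_num
    linear_combination (|Ring.choose a (j + J)| * |Ring.choose a j| * ((1 / 2:ℝ) ^ j * (1 / 2) ^ j)) * this
  have e : Ring.choose a J = ∑' j : ℕ, (if j = 0 then Ring.choose a J else 0) := by
    rw [tsum_ite_eq]
  rw [e]
  refine tendsto_tsum_of_dominated_convergence h3 ?_ ?_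
  · intro j
    have : Continuous fun r : ℝ => Ring.choose a (j + J) * Ring.choose a j * r ^ (2 * j) := by fun_prop
    have h5 := (this.tendsto 0).mono_left (nhdsWithin_le_nhds (s := Set.Ioi (0:ℝ)))
    convert h5 using 2
    split_ifs with hj
    · subst hj; simp [Ring.choose_zero_right]
    · rw [zero_pow (by omega), mul_zero]
  · have : Set.Ioo (0 : ℝ) (1 / 2) ∈ 𝓝[>] (0 : ℝ) := Ioo_mem_nhdsGT (by norm_num)
    filter_upwards [this] with r hr j
    rw [norm_mul, Real.norm_eq_abs, norm_pow, Real.norm_of_nonneg hr.1.le]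
    have := hr.1; have := hr.2.le
    gcongr

theorem sg_exists_r {q : ℝ} (hq : 2 ≤ q) (hqodd : ∀ k : ℕ, q ≠ 2 * k) :
    ∃ r : ℝ, 0 < r ∧ r < 1 ∧ ∃ J : ℕ, 2 ≤ J ∧ sgCoef (q / 2) r J * sgCoef (q / 2) r 1 < 0 := by
  obtain ⟨J, hJ⟩ := sg_choose_neg (q / 2) (fun k h => hqodd k (by linarith))
  have hJ2 : 2 ≤ J := by
    by_contra! h
    interval_cases J
    · rw [Ring.choose_zero_right] at hJ; linarith
    · rw [Ring.choose_one_right] at hJ; linarith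
  have h1 := (sg_coef_tendsto (q / 2) J).eventually_lt_const hJ
  have h2 := (sg_coef_tendsto (q / 2) 1).eventually_const_lt (u := 0) (by rw [Ring.choose_one_right]; linarith)
  have h3 : Set.Ioo (0 : ℝ) 1 ∈ 𝓝[>] (0 : ℝ) := Ioo_mem_nhdsGT (by norm_num)
  obtain ⟨r, ⟨hr1, hr2⟩, hr3⟩ := ((h1.and h2).and h3).exists
  refine ⟨r, hr3.1, hr3.2, J, hJ2, ?_⟩
  have e1 := sg_coef_nat (a := q / 2) (r := r) 1
  rw [Nat.cast_one] at e1
  rw [sg_coef_nat, e1]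
  have := hr3.1
  exact mul_neg_of_neg_of_pos (mul_neg_of_pos_of_neg (by positivity) hr1) (mul_pos (by positivity) hr2)

theorem sg_fourier_gauss {d : ℕ} {p : ℝ} (hp : 0 < p) (a ξ : EuclideanSpace ℝ (Fin d)) :
    𝓕 (fun x : EuclideanSpace ℝ (Fin d) => ((Real.exp (-(π / p) * ‖x - a‖ ^ 2) : ℝ) : ℂ)) ξ =
      ((p ^ ((d : ℝ) / 2) * Real.exp (-(π * p) * ‖ξ‖ ^ 2) : ℝ) : ℂ) *
        Complex.exp (((-2 * π * inner ℝ a ξ : ℝ) : ℂ) * Complex.I) := by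
  rw [Real.fourier_eq', ← integral_add_right_eq_self _ a]
  have hb : 0 < ((π / p : ℝ) : ℂ).re := by rw [Complex.ofReal_re]; positivity
  have h := GaussianFourier.integral_cexp_neg_mul_sq_norm_add hb (-2 * π * Complex.I) ξ
  have e1 : ∀ v : EuclideanSpace ℝ (Fin d),
      Complex.exp (((-2 * π * inner ℝ (v + a) ξ : ℝ) : ℂ) * Complex.I) •
        ((Real.exp (-(π / p) * ‖v + a - a‖ ^ 2) : ℝ) : ℂ) =
      Complex.exp (-((π / p : ℝ) : ℂ) * ‖v‖ ^ 2 + -2 * π * Complex.I * (inner ℝ ξ v : ℝ)) *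
        Complex.exp (((-2 * π * inner ℝ a ξ : ℝ) : ℂ) * Complex.I) := by
    intro v
    rw [add_sub_cancel_right, smul_eq_mul, Complex.ofReal_exp, ← Complex.exp_add,
      ← Complex.exp_add, inner_add_left, real_inner_comm ξ v]
    congr 1
    push_cast
    ring
  simp_rw [e1]
  rw [integral_mul_const, h]
  congr 1
  rw [finrank_euclideanSpace, Fintype.card_fin]
  have hpc : (p : ℂ) ≠ 0 := by exact_mod_cast hp.ne'
  have hpi : (π : ℂ) ≠ 0 := by exact_mod_cast Real.pi_ne_zero
  have e2 : (π : ℂ) / ((π / p : ℝ) : ℂ) = (p : ℂ) := by push_cast; field_simp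
  rw [e2]
  push_cast
  rw [Complex.ofReal_cpow hp.le]
  push_cast
  congr 2
  rw [show (-2 * (π : ℂ) * Complex.I) ^ 2 = 4 * π ^ 2 * (Complex.I ^ 2) by ring, Complex.I_sq]
  field_simp

/-- the trigonometric polynomial -/
noncomputable def sgD (r m n u : ℝ) : ℂ :=
  (1 + r * Complex.exp (((2 * π * (m * u) : ℝ) : ℂ) * Complex.I)) *
    (1 + r * Complex.exp (((2 * π * (n * u) : ℝ) : ℂ) * Complex.I))

/-- gaussian profile -/
noncomputable def sgK (d : ℕ) (p : ℝ) (ξ : EuclideanSpace ℝ (Fin d)) : ℝ :=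
  p ^ ((d : ℝ) / 2) * Real.exp (-(π * p) * ‖ξ‖ ^ 2)

theorem sg_fourier_Gsum {d : ℕ} {ι : Type*} [Fintype ι] {p : ℝ} (hp : 0 < p) (w N : ι → ℝ) (t : ℝ)
    (e ξ : EuclideanSpace ℝ (Fin d)) :
    𝓕 (fun x => ((sgG w N e p t x : ℝ) : ℂ)) ξ =
      (sgK d p ξ : ℂ) * ∑ i, (w i : ℂ) *
        Complex.exp (((-2 * π * inner ℝ (t • (N i • e)) ξ : ℝ) : ℂ) * Complex.I) := by
  have hint : ∀ a : EuclideanSpace ℝ (Fin d), ∀ c : ℝ, Integrable (fun x : EuclideanSpace ℝ (Fin d) =>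
      Complex.exp (((-2 * π * inner ℝ x ξ : ℝ) : ℂ) * Complex.I) • ((c : ℂ) *
      ((Real.exp (-(π / p) * ‖x - a‖ ^ 2) : ℝ) : ℂ))) := by
    intro a c
    have h := ((sg_gauss_int (d := d) (κ := π / p) (by positivity)).comp_sub_right a).const_mul |c|
    refine h.mono' (by fun_prop) (ae_of_all _ fun x => ?_)
    rw [norm_smul, Complex.norm_exp_ofReal_mul_I, one_mul, norm_mul, Complex.norm_real,
      Complex.norm_real, Real.norm_eq_abs, Real.norm_of_nonneg (Real.exp_pos _).le]
  have e1 : ∀ (c : ℝ) (a : EuclideanSpace ℝ (Fin d)), ∫ x : EuclideanSpace ℝ (Fin d),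
      Complex.exp (((-2 * π * inner ℝ x ξ : ℝ) : ℂ) * Complex.I) • ((c : ℂ) *
      ((Real.exp (-(π / p) * ‖x - a‖ ^ 2) : ℝ) : ℂ)) =
      c * ((sgK d p ξ : ℂ) * Complex.exp (((-2 * π * inner ℝ a ξ : ℝ) : ℂ) * Complex.I)) := by
    intro c a
    rw [sgK, ← sg_fourier_gauss hp a ξ, Real.fourier_eq', ← integral_const_mul]
    congr 1; ext x; simp only [smul_eq_mul]; ring
  have e2 : ∀ v : EuclideanSpace ℝ (Fin d), Complex.exp (((-2 * π * inner ℝ v ξ : ℝ) : ℂ) * Complex.I) •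
      ((sgG w N e p t v : ℝ) : ℂ) = ∑ i, Complex.exp (((-2 * π * inner ℝ v ξ : ℝ) : ℂ) * Complex.I) •
      (((w i : ℝ) : ℂ) * ((Real.exp (-(π / p) * ‖v - t • (N i • e)‖ ^ 2) : ℝ) : ℂ)) := by
    intro v
    rw [← Finset.smul_sum, sgG, Complex.ofReal_sum]
    simp only [Complex.ofReal_mul]
  rw [Real.fourier_eq', integral_congr_ae (ae_of_all _ e2), integral_finsetSum _ (fun i _ => hint _ _),
    Finset.mul_sum]
  refine Finset.sum_congr rfl fun i _ => ?_
  rw [e1]; ring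

theorem sg_fourier_G {d : ℕ} {p : ℝ} (hp : 0 < p) (r m n t : ℝ) (e ξ : EuclideanSpace ℝ (Fin d)) :
    𝓕 (fun x => ((sgG ![1, r, r, r ^ 2] ![0, m, n, m + n] e p t x : ℝ) : ℂ)) ξ =
      (sgK d p ξ : ℂ) * sgD r m n (t * -(inner ℝ e ξ)) := by
  rw [sg_fourier_Gsum hp, sgD]
  congr 1
  have h : ∀ a : ℝ, Complex.exp (((-2 * π * inner ℝ (t • (a • e)) ξ : ℝ) : ℂ) * Complex.I) =
      Complex.exp (((2 * π * (a * (t * -(inner ℝ e ξ))) : ℝ) : ℂ) * Complex.I) := by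
    intro a
    rw [real_inner_smul_left, real_inner_smul_left]
    congr 3; ring
  simp only [h]
  have h2 : Complex.exp (((2 * π * ((m + n) * (t * -(inner ℝ e ξ))) : ℝ) : ℂ) * Complex.I) =
    Complex.exp (((2 * π * (m * (t * -(inner ℝ e ξ))) : ℝ) : ℂ) * Complex.I) *
    Complex.exp (((2 * π * (n * (t * -(inner ℝ e ξ))) : ℝ) : ℂ) * Complex.I) := by
    rw [← Complex.exp_add]; congr 1; push_cast; ring
  simp only [Fin.sum_univ_four, Matrix.cons_val, h2, zero_mul, mul_zero, Complex.ofReal_zero, Complex.exp_zero, Complex.ofReal_one, Complex.ofReal_pow]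
  ring


theorem sg_hasSum_mul (f g : ℤ → ℂ) (W V : ℂ) (h : HasSum f W) (h2 : HasSum g V) :
    HasSum (fun y : ℤ × ℤ => f y.1 * g y.2) (W * V) := by
  have hs := summable_mul_of_summable_norm (f := f) (g := g) h.summable.norm h2.summable.norm
  exact h.mul h2 hs

theorem sg_D_hasSum {q r : ℝ} (hr0 : 0 ≤ r) (hr : r < 1) (m n : ℤ) (u : ℝ) :
    HasSum (fun z : ℤ × ℤ => ((sgCoef (q / 2) r z.1 * sgCoef (q / 2) r z.2 : ℝ) : ℂ) *
      Complex.exp (((2 * π * (((m * z.1 + n * z.2 : ℤ) : ℝ) * u) : ℝ) : ℂ) * Complex.I))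
      ((‖sgD r m n u‖ ^ q : ℝ) : ℂ) := by
  have hm := sg_coef_hasSum (q := q) hr0 hr (Complex.exp (((2 * π * (m * u) : ℝ) : ℂ) * Complex.I))
    (Complex.norm_exp_ofReal_mul_I _)
  have hn := sg_coef_hasSum (q := q) hr0 hr (Complex.exp (((2 * π * (n * u) : ℝ) : ℂ) * Complex.I))
    (Complex.norm_exp_ofReal_mul_I _)
  have h := sg_hasSum_mul _ _ _ _ hm hn
  rw [sgD, norm_mul, Real.mul_rpow (norm_nonneg _) (norm_nonneg _), Complex.ofReal_mul]
  refine HasSum.congr_fun h fun z => ?_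
  have e1 : Complex.exp (((2 * π * (((m * z.1 + n * z.2 : ℤ) : ℝ) * u) : ℝ) : ℂ) * Complex.I) =
    Complex.exp (((2 * π * (m * u) : ℝ) : ℂ) * Complex.I) ^ z.1 *
    Complex.exp (((2 * π * (n * u) : ℝ) : ℂ) * Complex.I) ^ z.2 := by
    rw [← Complex.exp_int_mul, ← Complex.exp_int_mul, ← Complex.exp_add]
    congr 1; push_cast; ring
  rw [e1]; push_cast; ring

theorem sg_gauss_osc {d : ℕ} {b : ℝ} (hb : 0 < b) (e : EuclideanSpace ℝ (Fin d)) (he : ‖e‖ = 1) (k : ℤ) (t : ℝ) :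
    ∫ ξ : EuclideanSpace ℝ (Fin d), ((Real.exp (-(π * b) * ‖ξ‖ ^ 2) : ℝ) : ℂ) *
      Complex.exp (((2 * π * ((k : ℝ) * (t * -(inner ℝ e ξ))) : ℝ) : ℂ) * Complex.I) =
    (((1 / b) ^ ((d : ℝ) / 2) * Real.exp (-(π / b) * t ^ 2) ^ (k.natAbs ^ 2) : ℝ) : ℂ) := by
  have hb' : 0 < ((π * b : ℝ) : ℂ).re := by rw [Complex.ofReal_re]; positivity
  have h := GaussianFourier.integral_cexp_neg_mul_sq_norm_add hb' (-2 * π * k * t * Complex.I) e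
  have e1 : ∀ ξ : EuclideanSpace ℝ (Fin d), ((Real.exp (-(π * b) * ‖ξ‖ ^ 2) : ℝ) : ℂ) *
      Complex.exp (((2 * π * ((k : ℝ) * (t * -(inner ℝ e ξ))) : ℝ) : ℂ) * Complex.I) =
      Complex.exp (-((π * b : ℝ) : ℂ) * ‖ξ‖ ^ 2 + -2 * π * k * t * Complex.I * (inner ℝ e ξ : ℝ)) := by
    intro v
    rw [Complex.ofReal_exp, ← Complex.exp_add]
    congr 1
    push_cast
    ring
  rw [integral_congr_ae (ae_of_all _ e1), h, finrank_euclideanSpace, Fintype.card_fin, he]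
  have hpc : (b : ℂ) ≠ 0 := by exact_mod_cast hb.ne'
  have hpi : (π : ℂ) ≠ 0 := by exact_mod_cast Real.pi_ne_zero
  have e2 : (π : ℂ) / ((π * b : ℝ) : ℂ) = ((1 / b : ℝ) : ℂ) := by push_cast; field_simp
  rw [e2, ← Real.exp_nat_mul]
  rw [Complex.ofReal_mul (_ ^ _), Complex.ofReal_cpow (by positivity), Complex.ofReal_exp]
  congr 1
  · push_cast; rfl
  · congr 1
    have e3 : ((k.natAbs : ℝ)) ^ 2 = (k : ℝ) ^ 2 := by
      rw [Nat.cast_natAbs, Int.cast_abs, sq_abs]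
    rw [Nat.cast_pow, e3]
    push_cast
    rw [show (-2 * (π : ℂ) * k * t * Complex.I) ^ 2 = 4 * π ^ 2 * k ^ 2 * t ^ 2 * (Complex.I ^ 2) by ring, Complex.I_sq]
    field_simp

theorem sg_main {d : ℕ} {p q r : ℝ} (hp : 1 ≤ p) (hq : 2 ≤ q) (hr0 : 0 ≤ r) (hr : r < 1) 
    (e : EuclideanSpace ℝ (Fin d)) (he : ‖e‖ = 1) :
    ∃ C > 0, ∀ (m n : ℤ) (t : ℝ), 
      HasSum (fun z : ℤ × ℤ => C * (sgCoef (q / 2) r z.1 * sgCoef (q / 2) r z.2 *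
        Real.exp (-(π / (p * q)) * t ^ 2) ^ ((m * z.1 + n * z.2).natAbs ^ 2)))
      (∫ ξ, ‖𝓕 (fun x => ((sgG ![1, r, r, r ^ 2] ![0, (m : ℝ), n, m + n] e p t x : ℝ) : ℂ)) ξ‖ ^ q) := by
  have hp0 : 0 < p := by linarith
  have hpq : 0 < p * q := by positivity
  refine ⟨(p ^ ((d : ℝ) / 2)) ^ q * (1 / (p * q)) ^ ((d : ℝ) / 2), by positivity, fun m n t => ?_⟩
  have hK : ∀ ξ : EuclideanSpace ℝ (Fin d), sgK d p ξ ^ q =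
      (p ^ ((d : ℝ) / 2)) ^ q * Real.exp (-(π * (p * q)) * ‖ξ‖ ^ 2) := by
    intro ξ
    rw [sgK, Real.mul_rpow (by positivity) (Real.exp_pos _).le, ← Real.exp_mul]
    congr 2; ring
  have hint := (sg_gauss_int (d := d) (κ := π * (p * q)) (by positivity)).const_mul ((p ^ ((d : ℝ) / 2)) ^ q)
  have hAs := sg_coef_summable (q / 2) hr0 hr
  have hAA : Summable (fun z : ℤ × ℤ => |sgCoef (q / 2) r z.1 * sgCoef (q / 2) r z.2|) := by
    have := summable_mul_of_summable_norm hAs.norm hAs.norm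
    refine this.congr fun z => ?_
    rw [abs_mul]
  set A := sgCoef (q / 2) r with hA
  let F : ℤ × ℤ → EuclideanSpace ℝ (Fin d) → ℂ := fun z ξ => ((sgK d p ξ ^ q : ℝ) : ℂ) *
    (((A z.1 * A z.2 : ℝ) : ℂ) *
      Complex.exp (((2 * π * (((m * z.1 + n * z.2 : ℤ) : ℝ) * (t * -(inner ℝ e ξ))) : ℝ) : ℂ) * Complex.I))
  have hn : ∀ z ξ, ‖F z ξ‖ = |A z.1 * A z.2| * ((p ^ ((d : ℝ) / 2)) ^ q * Real.exp (-(π * (p * q)) * ‖ξ‖ ^ 2)) := by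
    intro z ξ
    simp only [F]
    rw [norm_mul, norm_mul, Complex.norm_exp_ofReal_mul_I, Complex.norm_real, Complex.norm_real,
      Real.norm_eq_abs, Real.norm_eq_abs, hK, abs_of_nonneg (by positivity : 0 ≤ (p ^ ((d : ℝ) / 2)) ^ q * Real.exp (-(π * (p * q)) * ‖ξ‖ ^ 2))]
    ring
  have hFi : ∀ z, Integrable (F z) := by
    intro z
    refine (hint.const_mul |A z.1 * A z.2|).mono' ?_ (ae_of_all _ fun ξ => (hn z ξ).le)
    simp only [F, hK]
    fun_prop
  have hFs : Summable fun z => ∫ ξ, ‖F z ξ‖ := by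
    simp_rw [hn, integral_const_mul]
    exact hAA.mul_right _
  have h := hasSum_integral_of_summable_integral_norm hFi hFs
  have e1 : ∀ ξ, ∑' z, F z ξ = (((‖𝓕 (fun x => ((sgG ![1, r, r, r ^ 2] ![0, (m : ℝ), n, m + n] e p t x : ℝ) : ℂ)) ξ‖ ^ q) : ℝ) : ℂ) := by
    intro ξ
    have h3 := (sg_D_hasSum (q := q) hr0 hr m n (t * -(inner ℝ e ξ))).mul_left ((sgK d p ξ ^ q : ℝ) : ℂ)
    rw [sg_fourier_G hp0, norm_mul, Complex.norm_real, Real.norm_of_nonneg (by rw [sgK]; positivity),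
      Real.mul_rpow (by rw [sgK]; positivity) (norm_nonneg _), Complex.ofReal_mul]
    exact h3.tsum_eq
  simp_rw [e1] at h
  rw [integral_complex_ofReal] at h
  refine Complex.hasSum_ofReal.1 (h.congr_fun fun z => ?_)
  have h4 := sg_gauss_osc hpq e he (m * z.1 + n * z.2) t
  simp only [F, hK]
  have e5 : ∀ ξ : EuclideanSpace ℝ (Fin d), (((p ^ ((d : ℝ) / 2)) ^ q * Real.exp (-(π * (p * q)) * ‖ξ‖ ^ 2) : ℝ) : ℂ) *
    (((A z.1 * A z.2 : ℝ) : ℂ) *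
      Complex.exp (((2 * π * (((m * z.1 + n * z.2 : ℤ) : ℝ) * (t * -(inner ℝ e ξ))) : ℝ) : ℂ) * Complex.I)) =
    (((p ^ ((d : ℝ) / 2)) ^ q * (A z.1 * A z.2) : ℝ) : ℂ) * (((Real.exp (-(π * (p * q)) * ‖ξ‖ ^ 2) : ℝ) : ℂ) *
      Complex.exp (((2 * π * (((m * z.1 + n * z.2 : ℤ) : ℝ) * (t * -(inner ℝ e ξ))) : ℝ) : ℂ) * Complex.I)) := by
    intro ξ; push_cast; ring
  rw [integral_congr_ae (ae_of_all _ e5), integral_const_mul, h4, ← Complex.ofReal_mul]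
  congr 1
  ring

theorem sg_pow_diff {X Y : ℝ} (hY : 0 ≤ Y) (hYX : Y ≤ X) (hX : X ≤ 1 / 2) (n : ℕ) :
    X ^ (n + 2) - Y ^ (n + 2) ≤ 2 * X * (X - Y) := by
  induction n with
  | zero => simp only [zero_add]; nlinarith [sq_nonneg (X - Y)]
  | succ n ih =>
    have h1 : Y ^ (n + 2) ≤ X := by
      calc Y ^ (n + 2) ≤ Y ^ 1 := pow_le_pow_of_le_one hY (by linarith) (by omega)
        _ ≤ X := by simpa using hYX
    have h2 : X ^ (n + 1 + 2) - Y ^ (n + 1 + 2) = X * (X ^ (n + 2) - Y ^ (n + 2)) + Y ^ (n + 2) * (X - Y) := by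
      ring
    rw [h2]
    have h3 : X * (X ^ (n + 2) - Y ^ (n + 2)) ≤ X * (2 * X * (X - Y)) := by
      gcongr; linarith
    have h4 : 0 ≤ X * (X - Y) := mul_nonneg (by linarith) (by linarith)
    nlinarith [mul_le_mul_of_nonneg_right h1 (sub_nonneg.2 hYX)]

theorem sg_pointwise {A : ℤ → ℝ} (hAn : ∀ k, A (-k) = A k) {J : ℕ}
    (hneg : A J * A 1 < 0) {m : ℤ} (hm : 4 ≤ m) {X Y : ℝ} (hY : 0 < Y) (hYX : Y ≤ X)
    (hX : X ≤ 1 / 2) (z : ℤ × ℤ) :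
    (X - Y) * ((if z = (-(J : ℤ), 1) then -(A J * A 1) else 0) -
      (if m - 1 ≤ |z.2| then |A z.1 * A z.2| else 0) - 2 * X * |A z.1 * A z.2|) ≤
    A z.1 * A z.2 * Y ^ ((m * z.1 + (m * J + 1) * z.2).natAbs ^ 2) -
      A z.1 * A z.2 * X ^ ((m * z.1 + (m * J + 1) * z.2).natAbs ^ 2) := by
  obtain ⟨a, b⟩ := z
  simp only
  set L := A a * A b with hL
  have hXY : 0 ≤ X - Y := by linarith
  have hX0 : 0 ≤ X := by linarith
  have hLa := abs_nonneg L
  have hti : 0 ≤ (if m - 1 ≤ |b| then |L| else 0) := by split_ifs <;> simp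
  have hXL : 0 ≤ 2 * X * |L| := by positivity
  rcases Nat.lt_or_ge (m * a + (m * J + 1) * b).natAbs 2 with hk | hk
  · rcases Nat.lt_or_ge (m * a + (m * J + 1) * b).natAbs 1 with hk0 | hk1
    · have h0 : (m * a + (m * J + 1) * b).natAbs = 0 := by omega
      rw [h0]
      have hne : (a, b) ≠ (-(J : ℤ), 1) := by
        rintro h
        rw [Prod.mk.injEq] at h
        rw [h.1, h.2, Int.natAbs_eq_zero] at h0
        have : m * -(J : ℤ) + (m * J + 1) * 1 = 1 := by ring
        omega
      rw [if_neg hne]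
      simp only [ne_eq, OfNat.ofNat_ne_zero, not_false_eq_true, zero_pow, pow_zero, sub_self]
      exact mul_nonpos_of_nonneg_of_nonpos hXY (by linarith)
    · have h1 : (m * a + (m * J + 1) * b).natAbs = 1 := by omega
      rw [h1]
      simp only [one_pow, pow_one]
      have key : (a, b) = (-(J : ℤ), 1) ∨ (a, b) = ((J : ℤ), -1) ∨ m - 1 ≤ |b| := by
        rcases Int.natAbs_eq_iff.1 h1 with h | h
        · have h' : m * (a + J * b) = 1 - b := by push_cast at h; linarith
          by_cases hb : b = 1
          · left
            subst hb
            have : a + J * 1 = 0 := by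
              rcases mul_eq_zero.1 (h'.trans (by ring)) with h | h
              · omega
              · exact h
            ext <;> simp; omega
          · right; right
            have h2 : m ≤ |1 - b| := Int.le_of_dvd (abs_pos.2 (by omega)) ((dvd_abs _ _).2 ⟨_, h'.symm⟩)
            have h3 : |1 - b| ≤ 1 + |b| := by
              have := abs_sub 1 b; simpa using this
            omega
        · have h' : m * (a + J * b) = -1 - b := by push_cast at h; linarith
          by_cases hb : b = -1
          · right; left
            subst hb
            have : a + J * (-1) = 0 := by
              rcases mul_eq_zero.1 (h'.trans (by ring)) with h | h
              · omega
              · exact h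
            ext <;> simp; omega
          · right; right
            have h2 : m ≤ |-1 - b| := Int.le_of_dvd (abs_pos.2 (by omega)) ((dvd_abs _ _).2 ⟨_, h'.symm⟩)
            have h3 : |-1 - b| ≤ 1 + |b| := by
              have := abs_sub (-1) b; simpa using this
            omega
      by_cases hz : (a, b) = (-(J : ℤ), 1)
      · rw [if_pos hz]
        have h2 := hz
        rw [Prod.mk.injEq] at h2
        have : L = A J * A 1 := by rw [hL, h2.1, h2.2, hAn]
        rw [← this]
        nlinarith [mul_nonneg hXY hti, mul_nonneg hXY hXL]
      · rw [if_neg hz]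
        rcases key with h | h | h
        · exact absurd h hz
        · rw [Prod.mk.injEq] at h
          have : L = A J * A 1 := by rw [hL, h.1, h.2, hAn]
          rw [← this] at hneg
          nlinarith [mul_nonneg hXY hti, mul_nonneg hXY hXL]
        · rw [if_pos h]
          nlinarith [mul_nonneg hXY hXL, mul_le_mul_of_nonneg_left (le_abs_self L) hXY]
  · have hne : (a, b) ≠ (-(J : ℤ), 1) := by
      rintro h
      rw [Prod.mk.injEq] at h
      rw [h.1, h.2, show m * -(J : ℤ) + (m * J + 1) * 1 = 1 by ring] at hk
      simp at hk
    rw [if_neg hne]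
    obtain ⟨j, hj⟩ : ∃ j, (m * a + (m * J + 1) * b).natAbs ^ 2 = j + 2 :=
      ⟨(m * a + (m * J + 1) * b).natAbs ^ 2 - 2, by nlinarith [Nat.sub_add_cancel (show 2 ≤ (m * a + (m * J + 1) * b).natAbs ^ 2 by nlinarith)]⟩
    rw [hj]
    have h5 := sg_pow_diff hY.le hYX hX j
    have h6 : 0 ≤ X ^ (j + 2) - Y ^ (j + 2) := sub_nonneg.2 (pow_le_pow_left₀ hY.le hYX _)
    have h7 : L * (X ^ (j + 2) - Y ^ (j + 2)) ≤ |L| * (2 * X * (X - Y)) :=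
      (mul_le_mul_of_nonneg_right (le_abs_self L) h6).trans (mul_le_mul_of_nonneg_left h5 hLa)
    nlinarith [mul_nonneg hXY hti]

theorem sg_lower {A : ℤ → ℝ} (hAs : Summable fun k => |A k|) (hAn : ∀ k, A (-k) = A k) {J : ℕ}
    (hneg : A J * A 1 < 0) :
    ∃ m : ℤ, 4 ≤ m ∧ ∃ c > 0, ∃ X₀ > 0, ∀ X Y SX SY : ℝ, 0 < Y → Y ≤ X → X ≤ X₀ →
      HasSum (fun z : ℤ × ℤ => A z.1 * A z.2 * X ^ ((m * z.1 + (m * J + 1) * z.2).natAbs ^ 2)) SX →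
      HasSum (fun z : ℤ × ℤ => A z.1 * A z.2 * Y ^ ((m * z.1 + (m * J + 1) * z.2).natAbs ^ 2)) SY →
      c * (X - Y) ≤ SY - SX := by
  have hAA : Summable (fun z : ℤ × ℤ => |A z.1 * A z.2|) := by
    have := summable_mul_of_summable_norm hAs.norm hAs.norm
    refine this.congr fun z => ?_
    rw [abs_mul]
  set δ := -(A J * A 1) with hδ
  have hδ0 : 0 < δ := by linarith
  have ht : Tendsto (fun M : ℕ => ∑' z : ℤ × ℤ, (if (M : ℤ) - 1 ≤ |z.2| then |A z.1 * A z.2| else 0))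
      atTop (𝓝 (∑' z : ℤ × ℤ, (0 : ℝ))) := by
    refine tendsto_tsum_of_dominated_convergence hAA ?_ ?_
    · intro z
      refine tendsto_const_nhds.congr' ?_
      filter_upwards [eventually_gt_atTop (|z.2| + 1).toNat] with M hM
      rw [if_neg (by omega)]
    · refine Eventually.of_forall fun M z => ?_
      split_ifs <;> simp <;> positivity
  rw [tsum_zero] at ht
  obtain ⟨M, hM1, hM2⟩ := ((ht.eventually_lt_const (show (0 : ℝ) < δ / 4 by linarith)).and
    (eventually_ge_atTop 4)).exists
  have hTs : Summable (fun z : ℤ × ℤ => (if (M : ℤ) - 1 ≤ |z.2| then |A z.1 * A z.2| else 0)) := by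
    refine hAA.of_norm_bounded fun z => ?_
    split_ifs <;> simp <;> positivity
  set Λ := ∑' z : ℤ × ℤ, |A z.1 * A z.2| with hΛ
  have hΛ0 : 0 ≤ Λ := tsum_nonneg fun _ => abs_nonneg _
  refine ⟨M, by omega, δ / 4, by positivity, min (1 / 2) (δ / (8 * (Λ + 1))), by positivity, ?_⟩
  intro X Y SX SY hY hYX hX hSX hSY
  have hX2 : X ≤ 1 / 2 := hX.trans (min_le_left _ _)
  have hX3 : X ≤ δ / (8 * (Λ + 1)) := hX.trans (min_le_right _ _)
  have hL := (((hasSum_ite_eq ((-(J : ℤ), (1 : ℤ)) : ℤ × ℤ) δ).sub hTs.hasSum).sub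
    (hAA.hasSum.mul_left (2 * X))).mul_left (X - Y)
  have hle := hasSum_le (fun z => sg_pointwise hAn hneg (by omega : (4 : ℤ) ≤ M) hY hYX hX2 z) hL (hSY.sub hSX)
  refine le_trans ?_ hle
  rw [mul_comm]
  refine mul_le_mul_of_nonneg_left ?_ (by linarith)
  rw [le_div_iff₀ (by positivity)] at hX3
  rw [← hΛ]
  have : 0 < X := by linarith
  nlinarith

theorem sg_rpow_int {d : ℕ} {q M : ℝ} (hq : 2 < q) (u : EuclideanSpace ℝ (Fin d) → ℂ) (hu : Continuous u)
    (hM : ∀ ξ, ‖u ξ‖ ≤ M) (hi : Integrable fun ξ => ‖u ξ‖ ^ 2) : Integrable fun ξ => ‖u ξ‖ ^ q := by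
  refine (hi.const_mul (M ^ (q - 2))).mono' ?_ (ae_of_all _ fun ξ => ?_)
  · exact (hu.norm.rpow_const fun x => Or.inr (by linarith)).aestronglyMeasurable
  · rw [Real.norm_of_nonneg (by positivity)]
    have h1 : ‖u ξ‖ ^ q = ‖u ξ‖ ^ (q - 2) * ‖u ξ‖ ^ 2 := by
      rw [← Real.rpow_natCast, ← Real.rpow_add_of_nonneg (norm_nonneg _) (by linarith) (by norm_num)]
      congr 1; push_cast; ring
    rw [h1]
    gcongr
    · exact hM ξ
    
theorem sg_amgm {x y l : ℝ} (hl : 0 < l) : x * y ≤ l * x ^ 2 / 2 + y ^ 2 / (2 * l) := by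
  have : 0 ≤ (l * x - y) ^ 2 / (2 * l) := by positivity
  have h2 : (l * x - y) ^ 2 / (2 * l) = l * x ^ 2 / 2 + y ^ 2 / (2 * l) - x * y := by field_simp; ring
  linarith

theorem sg_error {d : ℕ} {q M K ε h : ℝ} (hq : 2 < q) (hM : 0 ≤ M) (hε : 0 < ε) (hε1 : ε ≤ 1) (hh : 0 < h) 
    (b b' e e' : EuclideanSpace ℝ (Fin d) → ℂ)
    (cb : Continuous b) (cb' : Continuous b') (ce : Continuous e) (ce' : Continuous e')
    (mb : ∀ ξ, ‖b ξ‖ ≤ M) (mb' : ∀ ξ, ‖b' ξ‖ ≤ M) (me : ∀ ξ, ‖e ξ‖ ≤ M) (me' : ∀ ξ, ‖e' ξ‖ ≤ M)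
    (ib : Integrable fun ξ => ‖b ξ‖ ^ 2) (ib' : Integrable fun ξ => ‖b' ξ‖ ^ 2)
    (ie : Integrable fun ξ => ‖e ξ‖ ^ 2) (ie' : Integrable fun ξ => ‖e' ξ‖ ^ 2)
    (ide : Integrable fun ξ => ‖e ξ - e' ξ‖ ^ 2) (idb : Integrable fun ξ => ‖b ξ - b' ξ‖ ^ 2)
    (jb : ∫ ξ, ‖b ξ‖ ^ 2 ≤ K) (jb' : ∫ ξ, ‖b' ξ‖ ^ 2 ≤ K)
    (je : ∫ ξ, ‖e ξ‖ ^ 2 ≤ K * ε ^ 2) (je' : ∫ ξ, ‖e' ξ‖ ^ 2 ≤ K * ε ^ 2)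
    (jde : ∫ ξ, ‖e ξ - e' ξ‖ ^ 2 ≤ K * (ε * h) ^ 2) (jdb : ∫ ξ, ‖b ξ - b' ξ‖ ^ 2 ≤ K * h ^ 2) :
    |((∫ ξ, ‖b ξ + e ξ‖ ^ q) - ∫ ξ, ‖b ξ‖ ^ q) - ((∫ ξ, ‖b' ξ + e' ξ‖ ^ q) - ∫ ξ, ‖b' ξ‖ ^ q)| ≤
      q * q * (2 * M) ^ (q - 2) * (11 * K) * (ε * h) := by
  have hK : 0 ≤ K := le_trans (integral_nonneg fun _ => by positivity) jb
  have hadd : ∀ u v : EuclideanSpace ℝ (Fin d) → ℂ, Continuous u → Continuous v →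
      Integrable (fun ξ => ‖u ξ‖ ^ 2) → Integrable (fun ξ => ‖v ξ‖ ^ 2) →
      Integrable (fun ξ => ‖u ξ + v ξ‖ ^ 2) := by
    intro u v cu cv iu iv
    refine ((iu.add iv).const_mul 2).mono' (by fun_prop) (ae_of_all _ fun ξ => ?_)
    rw [Real.norm_of_nonneg (by positivity)]
    simp only [Pi.add_apply]
    have := norm_add_le (u ξ) (v ξ)
    have h3 := norm_nonneg (u ξ + v ξ)
    nlinarith [sq_nonneg (‖u ξ‖ - ‖v ξ‖)]
  have i1 := sg_rpow_int hq (fun ξ => b ξ + e ξ) (cb.add ce) (fun ξ => (norm_add_le _ _).trans (add_le_add (mb ξ) (me ξ)))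
    (hadd b e cb ce ib ie)
  have i2 := sg_rpow_int hq (fun ξ => b' ξ + e' ξ) (cb'.add ce') (fun ξ => (norm_add_le _ _).trans (add_le_add (mb' ξ) (me' ξ)))
    (hadd b' e' cb' ce' ib' ie')
  have i3 := sg_rpow_int hq b cb mb ib
  have i4 := sg_rpow_int hq b' cb' mb' ib'
  have i5 : Integrable (fun ξ => ‖b ξ + e ξ‖ ^ q - ‖b ξ‖ ^ q) := i1.sub i3
  have i6 : Integrable (fun ξ => ‖b' ξ + e' ξ‖ ^ q - ‖b' ξ‖ ^ q) := i2.sub i4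
  rw [← integral_sub i1 i3, ← integral_sub i2 i4, ← integral_sub i5 i6]
  refine abs_integral_le_integral_abs.trans ?_
  set Q := q * q * (2 * M) ^ (q - 2) with hQ
  have hQ0 : 0 ≤ Q := by positivity
  have hpt : ∀ ξ, |(‖b ξ + e ξ‖ ^ q - ‖b ξ‖ ^ q) - (‖b' ξ + e' ξ‖ ^ q - ‖b' ξ‖ ^ q)| ≤
      Q * ((2 * (ε * h)) * (‖b ξ‖ ^ 2 + ‖b' ξ‖ ^ 2 + ‖e ξ‖ ^ 2 + ‖e' ξ‖ ^ 2) + 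
        (1 / (2 * (ε * h))) * ‖e ξ - e' ξ‖ ^ 2 + (h / ε) * (‖e ξ‖ ^ 2 + ‖e' ξ‖ ^ 2) + 
        (1 / (2 * (h / ε))) * ‖b ξ - b' ξ‖ ^ 2) := by
    intro ξ
    refine (sg_four hq _ _ _ _ (mb ξ) (mb' ξ) (me ξ) (me' ξ)).trans ?_
    refine mul_le_mul_of_nonneg_left ?_ hQ0
    have a1 := sg_amgm (x := ‖b ξ‖ + ‖b' ξ‖ + ‖e ξ‖ + ‖e' ξ‖) (y := ‖e ξ - e' ξ‖) (l := ε * h) (by positivity)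
    have a2 := sg_amgm (x := ‖e ξ‖ + ‖e' ξ‖) (y := ‖b ξ - b' ξ‖) (l := h / ε) (by positivity)
    have a3 : (‖b ξ‖ + ‖b' ξ‖ + ‖e ξ‖ + ‖e' ξ‖) ^ 2 ≤ 4 * (‖b ξ‖ ^ 2 + ‖b' ξ‖ ^ 2 + ‖e ξ‖ ^ 2 + ‖e' ξ‖ ^ 2) := by
      nlinarith [sq_nonneg (‖b ξ‖ - ‖b' ξ‖), sq_nonneg (‖b ξ‖ - ‖e ξ‖), sq_nonneg (‖b ξ‖ - ‖e' ξ‖),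
        sq_nonneg (‖b' ξ‖ - ‖e ξ‖), sq_nonneg (‖b' ξ‖ - ‖e' ξ‖), sq_nonneg (‖e ξ‖ - ‖e' ξ‖)]
    have a4 : (‖e ξ‖ + ‖e' ξ‖) ^ 2 ≤ 2 * (‖e ξ‖ ^ 2 + ‖e' ξ‖ ^ 2) := by
      nlinarith [sq_nonneg (‖e ξ‖ - ‖e' ξ‖)]
    have a5 := mul_le_mul_of_nonneg_left a3 (show 0 ≤ ε * h by positivity)
    have a6 := mul_le_mul_of_nonneg_left a4 (show 0 ≤ h / ε by positivity)
    rw [div_eq_mul_one_div (‖e ξ - e' ξ‖ ^ 2)] at a1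
    rw [div_eq_mul_one_div (‖b ξ - b' ξ‖ ^ 2)] at a2
    linarith
  have ia : Integrable (fun ξ => ‖b ξ‖ ^ 2 + ‖b' ξ‖ ^ 2) := ib.add ib'
  have ia' : Integrable (fun ξ => ‖b ξ‖ ^ 2 + ‖b' ξ‖ ^ 2 + ‖e ξ‖ ^ 2) := ia.add ie
  have I1 : Integrable (fun ξ => ‖b ξ‖ ^ 2 + ‖b' ξ‖ ^ 2 + ‖e ξ‖ ^ 2 + ‖e' ξ‖ ^ 2) := ia'.add ie'
  have I2 : Integrable (fun ξ => ‖e ξ‖ ^ 2 + ‖e' ξ‖ ^ 2) := ie.add ie'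
  have J1 : ∫ ξ, (‖b ξ‖ ^ 2 + ‖b' ξ‖ ^ 2 + ‖e ξ‖ ^ 2 + ‖e' ξ‖ ^ 2) ≤ 4 * K := by
    rw [integral_add ia' ie', integral_add ia ie, integral_add ib ib']
    have : K * ε ^ 2 ≤ K * 1 := mul_le_mul_of_nonneg_left (by nlinarith) hK
    linarith
  have J2 : ∫ ξ, (‖e ξ‖ ^ 2 + ‖e' ξ‖ ^ 2) ≤ 2 * (K * ε ^ 2) := by
    rw [integral_add ie ie']; linarith
  have T1 := I1.const_mul (2 * (ε * h))
  have T2 := ide.const_mul (1 / (2 * (ε * h)))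
  have T3 := I2.const_mul (h / ε)
  have T4 := idb.const_mul (1 / (2 * (h / ε)))
  have T12 : Integrable (fun ξ => (2 * (ε * h)) * (‖b ξ‖ ^ 2 + ‖b' ξ‖ ^ 2 + ‖e ξ‖ ^ 2 + ‖e' ξ‖ ^ 2) +
        (1 / (2 * (ε * h))) * ‖e ξ - e' ξ‖ ^ 2) := T1.add T2
  have T13 : Integrable (fun ξ => (2 * (ε * h)) * (‖b ξ‖ ^ 2 + ‖b' ξ‖ ^ 2 + ‖e ξ‖ ^ 2 + ‖e' ξ‖ ^ 2) +
        (1 / (2 * (ε * h))) * ‖e ξ - e' ξ‖ ^ 2 + (h / ε) * (‖e ξ‖ ^ 2 + ‖e' ξ‖ ^ 2)) := T12.add T3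
  refine (integral_mono_of_nonneg (ae_of_all _ fun _ => abs_nonneg _)
    ((T13.add T4).const_mul Q) (ae_of_all _ hpt)).trans ?_
  simp only [Pi.add_apply]
  rw [integral_const_mul, integral_add T13 T4, integral_add T12 T3, integral_add T1 T2,
    integral_const_mul, integral_const_mul, integral_const_mul, integral_const_mul, mul_assoc Q (11 * K)]
  refine mul_le_mul_of_nonneg_left ?_ hQ0
  have k1 := mul_le_mul_of_nonneg_left J1 (show 0 ≤ 2 * (ε * h) by positivity)
  have k2 := mul_le_mul_of_nonneg_left jde (show 0 ≤ 1 / (2 * (ε * h)) by positivity)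
  have k3 := mul_le_mul_of_nonneg_left J2 (show 0 ≤ h / ε by positivity)
  have k4 := mul_le_mul_of_nonneg_left jdb (show 0 ≤ 1 / (2 * (h / ε)) by positivity)
  have l2 : 1 / (2 * (ε * h)) * (K * (ε * h) ^ 2) = K * (ε * h) / 2 := by field_simp
  have l3 : h / ε * (2 * (K * ε ^ 2)) = 2 * K * (ε * h) := by field_simp
  have l4 : 1 / (2 * (h / ε)) * (K * h ^ 2) = K * (ε * h) / 2 := by field_simp
  rw [l2] at k2
  rw [l3] at k3
  rw [l4] at k4
  have := add_le_add (add_le_add (add_le_add k1 k2) k3) k4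
  refine this.trans (le_of_eq (by ring))

theorem sg_cis (x y : ℝ) : ‖Complex.exp ((x : ℂ) * Complex.I) - Complex.exp ((y : ℂ) * Complex.I)‖ ≤ |x - y| := by
  have h1 : Complex.exp ((x : ℂ) * Complex.I) - Complex.exp ((y : ℂ) * Complex.I) =
      Complex.exp ((y : ℂ) * Complex.I) * (Complex.exp (Complex.I * ((x - y : ℝ) : ℂ)) - 1) := by
    rw [mul_sub, ← Complex.exp_add, mul_one]
    congr 2; push_cast; ring
  rw [h1, norm_mul, Complex.norm_exp_ofReal_mul_I, one_mul]
  exact Real.norm_exp_I_mul_ofReal_sub_one_le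

theorem sg_D_le {r : ℝ} (hr0 : 0 ≤ r) (hr : r ≤ 1) (m n u : ℝ) : ‖sgD r m n u‖ ≤ 4 := by
  have h : ∀ x : ℝ, ‖1 + (r : ℂ) * Complex.exp ((x : ℂ) * Complex.I)‖ ≤ 2 := by
    intro x
    refine (norm_add_le _ _).trans ?_
    rw [norm_mul, Complex.norm_exp_ofReal_mul_I, Complex.norm_real, Real.norm_of_nonneg hr0, norm_one]
    linarith
  rw [sgD, norm_mul]
  calc _ ≤ (2 : ℝ) * 2 := mul_le_mul (h _) (h _) (norm_nonneg _) (by norm_num)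
    _ = 4 := by norm_num

theorem sg_D_lip {r : ℝ} (hr0 : 0 ≤ r) (hr : r ≤ 1) (m n u v : ℝ) :
    ‖sgD r m n u - sgD r m n v‖ ≤ 4 * π * (|m| + |n|) * |u - v| := by
  have h : ∀ x : ℝ, ‖1 + (r : ℂ) * Complex.exp ((x : ℂ) * Complex.I)‖ ≤ 2 := by
    intro x
    refine (norm_add_le _ _).trans ?_
    rw [norm_mul, Complex.norm_exp_ofReal_mul_I, Complex.norm_real, Real.norm_of_nonneg hr0, norm_one]
    linarith
  have h2 : ∀ k : ℝ, ‖(1 + (r : ℂ) * Complex.exp (((2 * π * (k * u) : ℝ) : ℂ) * Complex.I)) -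
      (1 + (r : ℂ) * Complex.exp (((2 * π * (k * v) : ℝ) : ℂ) * Complex.I))‖ ≤ 2 * π * |k| * |u - v| := by
    intro k
    rw [add_sub_add_left_eq_sub, ← mul_sub, norm_mul, Complex.norm_real, Real.norm_of_nonneg hr0]
    have h3 := sg_cis (2 * π * (k * u)) (2 * π * (k * v))
    have h4 : |2 * π * (k * u) - 2 * π * (k * v)| = 2 * π * |k| * |u - v| := by
      rw [show 2 * π * (k * u) - 2 * π * (k * v) = 2 * π * (k * (u - v)) by ring, abs_mul, abs_mul k,
        abs_of_pos (by positivity : 0 < 2 * π)]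
      ring
    rw [h4] at h3
    calc _ ≤ 1 * (2 * π * |k| * |u - v|) := mul_le_mul hr h3 (norm_nonneg _) zero_le_one
      _ = _ := one_mul _
  rw [sgD, sgD]
  have hm := h2 m
  have hn := h2 n
  have a1 := h (2 * π * (m * v))
  have a2 := h (2 * π * (n * u))
  generalize (1 + (r : ℂ) * Complex.exp (((2 * π * (m * u) : ℝ) : ℂ) * Complex.I)) = a at *
  generalize (1 + (r : ℂ) * Complex.exp (((2 * π * (m * v) : ℝ) : ℂ) * Complex.I)) = a' at *
  generalize (1 + (r : ℂ) * Complex.exp (((2 * π * (n * u) : ℝ) : ℂ) * Complex.I)) = b at *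
  generalize (1 + (r : ℂ) * Complex.exp (((2 * π * (n * v) : ℝ) : ℂ) * Complex.I)) = b' at *
  have e1 : a * b - a' * b' = (a - a') * b + a' * (b - b') := by ring
  rw [e1]
  refine (norm_add_le _ _).trans ?_
  rw [norm_mul, norm_mul]
  have k1 := mul_le_mul hm a2 (norm_nonneg _) (by positivity)
  have k2 := mul_le_mul a1 hn (norm_nonneg _) (by positivity)
  linarith

theorem sg_b {d : ℕ} {p r : ℝ} (hp : 0 < p) (hr0 : 0 ≤ r) (hr : r ≤ 1) (m n : ℝ)
    (e : EuclideanSpace ℝ (Fin d)) (he : ‖e‖ = 1) :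
    ∃ M > 0, ∀ b : ℝ → EuclideanSpace ℝ (Fin d) → ℂ, (∀ t, b t =
      𝓕 (fun x => ((sgG ![1, r, r, r ^ 2] ![0, m, n, m + n] e p t x : ℝ) : ℂ))) → 
      ∀ t s : ℝ, Continuous (b t) ∧ (∀ ξ, ‖b t ξ‖ ≤ M) ∧ (Integrable fun ξ => ‖b t ξ‖ ^ 2) ∧
      ∫ ξ, ‖b t ξ‖ ^ 2 ≤ M ∧ (Integrable fun ξ => ‖b s ξ - b t ξ‖ ^ 2) ∧
      ∫ ξ, ‖b s ξ - b t ξ‖ ^ 2 ≤ M * (s - t) ^ 2 := by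
  have hg2 := sg_gauss_int (d := d) (κ := 2 * (π * p)) (by positivity)
  have hg1 := sg_gauss_int (d := d) (κ := π * p) (by positivity)
  set P := p ^ ((d : ℝ) / 2) with hP
  have hP0 : 0 < P := by positivity
  set L := 4 * π * (|m| + |n|) with hL
  have hL0 : 0 ≤ L := by positivity
  set I2 := ∫ x : EuclideanSpace ℝ (Fin d), Real.exp (-(2 * (π * p)) * ‖x‖ ^ 2) with hI2
  set I1 := ∫ x : EuclideanSpace ℝ (Fin d), Real.exp (-(π * p) * ‖x‖ ^ 2) with hI1
  have hI20 : 0 ≤ I2 := integral_nonneg fun _ => (Real.exp_pos _).le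
  have hI10 : 0 ≤ I1 := integral_nonneg fun _ => (Real.exp_pos _).le
  refine ⟨4 * P + 16 * P ^ 2 * I2 + P ^ 2 * L ^ 2 * (1 / (π * p)) * I1, by positivity, fun b hb t s => ?_⟩
  have hbf : ∀ t ξ, b t ξ = (sgK d p ξ : ℂ) * sgD r m n (t * -(inner ℝ e ξ)) := by
    intro t ξ; rw [hb, sg_fourier_G hp]
  have hcont : ∀ t, Continuous (b t) := by
    intro t
    rw [show b t = fun ξ => (sgK d p ξ : ℂ) * sgD r m n (t * -(inner ℝ e ξ)) from funext (hbf t)]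
    unfold sgK sgD
    fun_prop
  have hK0 : ∀ ξ : EuclideanSpace ℝ (Fin d), 0 ≤ sgK d p ξ := fun ξ => by rw [sgK]; positivity
  have hKsq : ∀ ξ : EuclideanSpace ℝ (Fin d), sgK d p ξ ^ 2 = P ^ 2 * Real.exp (-(2 * (π * p)) * ‖ξ‖ ^ 2) := by
    intro ξ
    rw [sgK, mul_pow, ← Real.exp_nat_mul]
    congr 2; push_cast; ring
  have hbn : ∀ ξ, ‖b t ξ‖ ≤ sgK d p ξ * 4 := by
    intro ξ
    rw [hbf, norm_mul, Complex.norm_real, Real.norm_of_nonneg (hK0 ξ)]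
    exact mul_le_mul_of_nonneg_left (sg_D_le hr0 hr _ _ _) (hK0 ξ)
  have hb2 : ∀ ξ, ‖b t ξ‖ ^ 2 ≤ 16 * P ^ 2 * Real.exp (-(2 * (π * p)) * ‖ξ‖ ^ 2) := by
    intro ξ
    have h1 : ‖b t ξ‖ ^ 2 ≤ (sgK d p ξ * 4) ^ 2 := pow_le_pow_left₀ (norm_nonneg _) (hbn ξ) 2
    rw [mul_pow, hKsq] at h1
    linarith
  have hd2 : ∀ ξ, ‖b s ξ - b t ξ‖ ^ 2 ≤ P ^ 2 * L ^ 2 * (1 / (π * p)) * (s - t) ^ 2 * Real.exp (-(π * p) * ‖ξ‖ ^ 2) := by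
    intro ξ
    have h1 : ‖b s ξ - b t ξ‖ ≤ sgK d p ξ * (L * (|s - t| * ‖ξ‖)) := by
      rw [hbf, hbf, ← mul_sub, norm_mul, Complex.norm_real, Real.norm_of_nonneg (hK0 ξ)]
      refine mul_le_mul_of_nonneg_left ((sg_D_lip hr0 hr _ _ _ _).trans ?_) (hK0 ξ)
      refine mul_le_mul_of_nonneg_left ?_ hL0
      rw [← sub_mul, abs_mul, abs_neg]
      refine mul_le_mul_of_nonneg_left ?_ (abs_nonneg _)
      have := abs_real_inner_le_norm e ξ
      rwa [he, one_mul] at this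
    have h2 := pow_le_pow_left₀ (norm_nonneg _) h1 2
    rw [mul_pow, hKsq, mul_pow L, mul_pow |s - t|, sq_abs] at h2
    refine h2.trans ?_
    have h3 : ‖ξ‖ ^ 2 ≤ 1 / (π * p) * Real.exp (π * p * ‖ξ‖ ^ 2) := by
      have := Real.add_one_le_exp (π * p * ‖ξ‖ ^ 2)
      rw [one_div, ← div_eq_inv_mul, le_div_iff₀ (by positivity)]
      linarith
    have h4 : Real.exp (-(2 * (π * p)) * ‖ξ‖ ^ 2) * Real.exp (π * p * ‖ξ‖ ^ 2) = Real.exp (-(π * p) * ‖ξ‖ ^ 2) := by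
      rw [← Real.exp_add]; congr 1; ring
    calc P ^ 2 * Real.exp (-(2 * (π * p)) * ‖ξ‖ ^ 2) * (L ^ 2 * ((s - t) ^ 2 * ‖ξ‖ ^ 2))
        ≤ P ^ 2 * Real.exp (-(2 * (π * p)) * ‖ξ‖ ^ 2) * (L ^ 2 * ((s - t) ^ 2 * (1 / (π * p) * Real.exp (π * p * ‖ξ‖ ^ 2)))) := by
          gcongr
      _ = _ := by rw [← h4]; ring
  have ib : Integrable fun ξ => ‖b t ξ‖ ^ 2 := by
    refine (hg2.const_mul (16 * P ^ 2)).mono' ((hcont t).norm.pow 2).aestronglyMeasurable (ae_of_all _ fun ξ => ?_)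
    rw [Real.norm_of_nonneg (by positivity)]
    exact hb2 ξ
  have idb : Integrable fun ξ => ‖b s ξ - b t ξ‖ ^ 2 := by
    refine (hg1.const_mul (P ^ 2 * L ^ 2 * (1 / (π * p)) * (s - t) ^ 2)).mono'
      (((hcont s).sub (hcont t)).norm.pow 2).aestronglyMeasurable (ae_of_all _ fun ξ => ?_)
    rw [Real.norm_of_nonneg (by positivity)]
    exact hd2 ξ
  have q1 : 0 ≤ 16 * P ^ 2 * I2 := by positivity
  have q2 : 0 ≤ P ^ 2 * L ^ 2 * (1 / (π * p)) * I1 := by positivity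
  refine ⟨hcont t, fun ξ => (hbn ξ).trans ?_, ib, ?_, idb, ?_⟩
  · have : sgK d p ξ ≤ P := by
      rw [sgK]
      refine mul_le_of_le_one_right hP0.le (Real.exp_le_one_iff.2 ?_)
      have : 0 ≤ π * p * ‖ξ‖ ^ 2 := by positivity
      linarith
    linarith
  · have := integral_mono ib (hg2.const_mul (16 * P ^ 2)) hb2
    rw [integral_const_mul] at this
    linarith
  · have := integral_mono idb (hg1.const_mul (P ^ 2 * L ^ 2 * (1 / (π * p)) * (s - t) ^ 2)) hd2
    rw [integral_const_mul] at this
    refine this.trans ?_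
    have q3 : 0 ≤ (4 * P + 16 * P ^ 2 * I2) * (s - t) ^ 2 := by positivity
    nlinarith

theorem sg_S_cont {d : ℕ} {ι : Type*} [Fintype ι] [Nonempty ι] (w N : ι → ℝ)
    (e : EuclideanSpace ℝ (Fin d)) (p : ℝ) (hw : ∀ i, 0 < w i) (t : ℝ) :
    Continuous (fun x => sgS w N e p t x ^ (1 / p)) := by
  have h1 : ∀ x, 0 < sgS w N e p t x := fun x =>
    Finset.sum_pos (fun i _ => mul_pos (Real.rpow_pos_of_pos (hw i) _) (Real.exp_pos _)) Finset.univ_nonempty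
  have h2 : Continuous (fun x => sgS w N e p t x) := by
    unfold sgS; fun_prop
  exact h2.rpow_const fun x => Or.inl (h1 x).ne'

theorem sg_G_cont {d : ℕ} {ι : Type*} [Fintype ι] (w N : ι → ℝ)
    (e : EuclideanSpace ℝ (Fin d)) (p : ℝ) (t : ℝ) :
    Continuous (fun x => sgG w N e p t x) := by
  unfold sgG; fun_prop

theorem sg_G_int {d : ℕ} {ι : Type*} [Fintype ι] (w N : ι → ℝ)
    (e : EuclideanSpace ℝ (Fin d)) {p : ℝ} (hp : 0 < p) (t : ℝ) :
    Integrable (fun x => sgG w N e p t x) := by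
  unfold sgG
  refine integrable_finsetSum _ fun i _ => ?_
  exact ((sg_gauss_int (d := d) (κ := π / p) (by positivity)).comp_sub_right (t • (N i • e))).const_mul (w i)

theorem sg_fourier_add {d : ℕ} (f g : EuclideanSpace ℝ (Fin d) → ℂ) (hf : Integrable f) (hg : Integrable g)
    (ξ : EuclideanSpace ℝ (Fin d)) : 𝓕 (fun x => f x + g x) ξ = 𝓕 f ξ + 𝓕 g ξ := by
  rw [Real.fourier_eq, Real.fourier_eq, Real.fourier_eq, ← integral_add]
  · congr 1; ext x; rw [smul_add]
  · exact (Real.fourierIntegral_convergent_iff ξ).2 hf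
  · exact (Real.fourierIntegral_convergent_iff ξ).2 hg

theorem sg_e {d : ℕ} {ι : Type*} [Fintype ι] [Nonempty ι] (w N : ι → ℝ)
    (e : EuclideanSpace ℝ (Fin d)) (p : ℝ) (hp : 1 ≤ p) (he : ‖e‖ = 1) (hw : ∀ i, 0 < w i)
    (hw1 : ∀ i, w i ≤ 1) (hN : ∀ i j, i ≠ j → 4 ≤ |N i - N j|) :
    ∃ M > 0, ∀ E : ℝ → EuclideanSpace ℝ (Fin d) → ℂ, (∀ t, E t =
      𝓕 (fun x => ((sgS w N e p t x ^ (1 / p) - sgG w N e p t x : ℝ) : ℂ))) →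
      ∀ t s : ℝ, 0 ≤ t → t ≤ s → Continuous (E t) ∧ (∀ ξ, ‖E t ξ‖ ≤ M) ∧
      (Integrable fun ξ => ‖E t ξ‖ ^ 2) ∧
      ∫ ξ, ‖E t ξ‖ ^ 2 ≤ M * Real.exp (-(π / (2 * p)) * t ^ 2) ^ 2 ∧
      (Integrable fun ξ => ‖E s ξ - E t ξ‖ ^ 2) ∧
      ∫ ξ, ‖E s ξ - E t ξ‖ ^ 2 ≤ M * (Real.exp (-(π / (2 * p)) * t ^ 2) * (s - t)) ^ 2 ∧
      ∀ ξ, 𝓕 (fun x => ((sgS w N e p t x ^ (1 / p) : ℝ) : ℂ)) ξ =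
        𝓕 (fun x => ((sgG w N e p t x : ℝ) : ℂ)) ξ + E t ξ := by
  obtain ⟨κ, hκ, C, hC, hE⟩ := sg_E w N e p hp he hw hw1 hN
  obtain ⟨c, hc, hfb⟩ := sg_fourier_bound (d := d) hκ
  have hp0 : 0 < p := by linarith
  refine ⟨C * c + C ^ 2 * c, by positivity, fun E hEd t s ht hts => ?_⟩
  set ε := Real.exp (-(π / (2 * p)) * t ^ 2) with hε
  have hε0 : 0 < ε := Real.exp_pos _
  have hε1 : ε ≤ 1 := by
    refine Real.exp_le_one_iff.2 ?_
    have : 0 ≤ π / (2 * p) * t ^ 2 := by positivity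
    linarith
  have hc1 : ∀ t, Continuous fun x => ((sgS w N e p t x ^ (1 / p) - sgG w N e p t x : ℝ) : ℂ) := fun t =>
    Complex.continuous_ofReal.comp ((sg_S_cont w N e p hw t).sub (sg_G_cont w N e p t))
  obtain ⟨i1, c1, b1, s1, j1⟩ := hfb _ (C * ε) (hc1 t) (by positivity) (fun x => by
    rw [Complex.norm_real, Real.norm_eq_abs]; exact (hE t s ht hts x).1)
  obtain ⟨i1s, -, -, -, -⟩ := hfb _ (C * Real.exp (-(π / (2 * p)) * s ^ 2)) (hc1 s) (by positivity) (fun x => by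
    rw [Complex.norm_real, Real.norm_eq_abs]; exact (hE s s (ht.trans hts) le_rfl x).1)
  obtain ⟨i2, c2, b2, s2, j2⟩ := hfb (fun x => ((sgS w N e p s x ^ (1 / p) - sgG w N e p s x : ℝ) : ℂ) -
      ((sgS w N e p t x ^ (1 / p) - sgG w N e p t x : ℝ) : ℂ)) (C * (s - t) * ε) ((hc1 s).sub (hc1 t))
    (mul_nonneg (mul_nonneg hC.le (by linarith)) hε0.le) (fun x => by
    rw [← Complex.ofReal_sub, Complex.norm_real, Real.norm_eq_abs]; exact (hE t s ht hts x).2)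
  have hsub : ∀ ξ, 𝓕 (fun x => ((sgS w N e p s x ^ (1 / p) - sgG w N e p s x : ℝ) : ℂ) -
      ((sgS w N e p t x ^ (1 / p) - sgG w N e p t x : ℝ) : ℂ)) ξ = E s ξ - E t ξ := by
    intro ξ
    rw [hEd, hEd, eq_sub_iff_add_eq, ← sg_fourier_add _ _ i2 i1]
    refine congrFun (congrArg 𝓕 (funext fun x => ?_)) ξ
    ring
  simp only [hsub] at s2 j2
  rw [← hEd] at c1 b1 s1 j1
  refine ⟨c1, fun ξ => (b1 ξ).trans ?_, s1, j1.trans ?_, s2, j2.trans ?_, fun ξ => ?_⟩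
  · have : C * ε * c ≤ C * 1 * c := by gcongr
    have : 0 ≤ C ^ 2 * c := by positivity
    linarith
  · have : 0 ≤ C * c * ε ^ 2 := by positivity
    linarith
  · have : 0 ≤ C * c * (ε * (s - t)) ^ 2 := by positivity
    linarith
  · have hGi : Integrable (fun x => ((sgG w N e p t x : ℝ) : ℂ)) := (sg_G_int w N e hp0 t).ofReal
    rw [hEd, ← sg_fourier_add _ _ hGi i1]
    refine congrFun (congrArg 𝓕 (funext fun x => ?_)) ξ
    push_cast; ring

theorem sg_step {α β c C T : ℝ} {Φ : ℝ → ℝ} (hα : 0 < α) (hαβ : α < β) (hc : 0 < c) (hC : 0 ≤ C)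
    (h : ∀ t s, T ≤ t → t < s → c * (Real.exp (-α * t ^ 2) - Real.exp (-α * s ^ 2)) -
      C * (Real.exp (-β * t ^ 2) * (s - t)) ≤ Φ s - Φ t) :
    ∃ t₀ > 0, StrictMonoOn Φ (Set.Ioi t₀) := by
  have hδ : 0 < β - α := by linarith
  refine ⟨1 + |T| + (3 * α + 1) / (β - α) + C / (c * α), by positivity, ?_⟩
  set t₀ := 1 + |T| + (3 * α + 1) / (β - α) + C / (c * α) with ht₀
  have g1 : 0 ≤ (3 * α + 1) / (β - α) := by positivity
  have g2 : 0 ≤ C / (c * α) := by positivity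
  have g3 := abs_nonneg T
  have g4 := le_abs_self T
  have hstep : ∀ t s, t₀ < t → t < s → s ≤ t + 1 → Φ t < Φ s := by
    intro t s ht hts hs1
    have ht1 : 1 < t := by linarith
    have h1 := h t s (by linarith) hts
    have h2 : Real.exp (-α * (t + 1) ^ 2) * (α * (s - t)) ≤ Real.exp (-α * t ^ 2) - Real.exp (-α * s ^ 2) := by
      have e1 : Real.exp (-α * t ^ 2) = Real.exp (-α * s ^ 2) * Real.exp (α * (s ^ 2 - t ^ 2)) := by
        rw [← Real.exp_add]; congr 1; ring
      have e2 := Real.add_one_le_exp (α * (s ^ 2 - t ^ 2))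
      have e3 : Real.exp (-α * (t + 1) ^ 2) ≤ Real.exp (-α * s ^ 2) := by
        apply Real.exp_le_exp.2
        have : s ^ 2 ≤ (t + 1) ^ 2 := pow_le_pow_left₀ (by linarith) hs1 2
        nlinarith
      have e4 : α * (s - t) ≤ Real.exp (α * (s ^ 2 - t ^ 2)) - 1 := by
        have : s - t ≤ s ^ 2 - t ^ 2 := by nlinarith
        nlinarith
      rw [e1]
      calc _ ≤ Real.exp (-α * s ^ 2) * (Real.exp (α * (s ^ 2 - t ^ 2)) - 1) :=
            mul_le_mul e3 e4 (mul_nonneg hα.le (by linarith)) (Real.exp_pos _).le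
        _ = _ := by ring
    have h3 : C * Real.exp (-β * t ^ 2) < c * α * Real.exp (-α * (t + 1) ^ 2) := by
      have f1 : 3 * α + 1 < (β - α) * t := by
        have : (3 * α + 1) / (β - α) < t := by linarith
        rw [div_lt_iff₀ hδ] at this; linarith
      have f2 : C < c * α * t := by
        have : C / (c * α) < t := by linarith
        rw [div_lt_iff₀ (by positivity)] at this; linarith
      have f3 : t ≤ β * t ^ 2 - α * (t + 1) ^ 2 := by nlinarith
      have f4 : C < c * α * Real.exp (β * t ^ 2 - α * (t + 1) ^ 2) := by
        refine f2.trans_le ?_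
        have := Real.add_one_le_exp (β * t ^ 2 - α * (t + 1) ^ 2)
        exact mul_le_mul_of_nonneg_left (by linarith) (by positivity)
      have f5 : Real.exp (-α * (t + 1) ^ 2) = Real.exp (β * t ^ 2 - α * (t + 1) ^ 2) * Real.exp (-β * t ^ 2) := by
        rw [← Real.exp_add]; congr 1; ring
      rw [f5, ← mul_assoc]
      exact mul_lt_mul_of_pos_right f4 (Real.exp_pos _)
    have h4 := mul_lt_mul_of_pos_right h3 (sub_pos.2 hts)
    have h5 := mul_le_mul_of_nonneg_left h2 hc.le
    linarith
  have hind : ∀ n : ℕ, ∀ t s, t₀ < t → t < s → s ≤ t + n → Φ t < Φ s := by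
    intro n
    induction n with
    | zero => intro t s _ h1 h2; simp at h2; linarith
    | succ n ih =>
      intro t s ht h1 h2
      push_cast at h2
      by_cases h3 : s ≤ t + 1
      · exact hstep t s ht h1 h3
      · push Not at h3
        exact (hstep t (t + 1) ht (by linarith) le_rfl).trans (ih (t + 1) s (by linarith) h3 (by linarith))
  intro t ht s _ hts
  obtain ⟨n, hn⟩ := exists_nat_ge (s - t)
  exact hind n t s ht hts (by linarith)

theorem sg_measure {d : ℕ} {ι : Type*} [Fintype ι] [Nonempty ι] (w N : ι → ℝ) (hw : ∀ i, 0 < w i)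
    (e : EuclideanSpace ℝ (Fin d)) (p : ℝ) :
    ∃ μ : Measure (EuclideanSpace ℝ (Fin d)), μ ≠ 0 ∧ IsFiniteMeasure μ ∧
      ∀ t x, slidingGaussian d μ t x = sgS w N e p t x := by
  have hfin : IsFiniteMeasure (∑ i, ENNReal.ofReal (w i ^ p) • Measure.dirac (N i • e)) := by
    refine ⟨?_⟩
    rw [Measure.finsetSum_apply]
    refine ENNReal.sum_lt_top.2 fun i _ => ?_
    simp
  refine ⟨∑ i, ENNReal.ofReal (w i ^ p) • Measure.dirac (N i • e), ?_, hfin, ?_⟩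
  · intro h0
    have h1 := congrArg (fun ν : Measure (EuclideanSpace ℝ (Fin d)) => ν Set.univ) h0
    simp only [Measure.finsetSum_apply, Measure.coe_zero, Pi.zero_apply, Finset.sum_eq_zero_iff] at h1
    have h2 := h1 (Classical.arbitrary ι) (Finset.mem_univ _)
    have h3 := Real.rpow_pos_of_pos (hw (Classical.arbitrary ι)) p
    simp at h2
    linarith
  · intro t x
    rw [slidingGaussian, sgS, integral_finsetSum_measure]
    · refine Finset.sum_congr rfl fun i _ => ?_
      rw [integral_smul_measure, integral_dirac, ENNReal.toReal_ofReal (Real.rpow_pos_of_pos (hw i) p).le, smul_eq_mul]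
    · intro i _
      exact (integrable_dirac (by simp)).smul_measure ENNReal.ofReal_ne_top

set_option maxHeartbeats 2000000 in
theorem sg_final {d : ℕ} (p q : ℝ) (hp : 1 ≤ p) (hq : 2 ≤ q) (hqodd : ∀ k : ℕ, q ≠ 2 * k)
    (e : EuclideanSpace ℝ (Fin d)) (he : ‖e‖ = 1) :
    ∃ μ : Measure (EuclideanSpace ℝ (Fin d)), μ ≠ 0 ∧ IsFiniteMeasure μ ∧
      ∃ t₀ > 0, StrictMonoOn (Qtilde d μ p q) (Set.Ioi t₀) := by
  have hq2 : 2 < q := lt_of_le_of_ne hq fun h => hqodd 1 (by push_cast; linarith)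
  have hp0 : 0 < p := by linarith
  obtain ⟨r, hr0, hr1, J, hJ2, hneg⟩ := sg_exists_r hq hqodd
  obtain ⟨C0, hC0, hmain⟩ := sg_main hp hq hr0.le hr1 e he
  obtain ⟨m, hm4, c, hc, X₀, hX₀, hlow⟩ := sg_lower (sg_coef_summable (q / 2) hr0.le hr1)
    (fun k => sg_coef_neg k) hneg
  obtain ⟨n, hn⟩ : ∃ n : ℤ, n = m * J + 1 := ⟨_, rfl⟩
  rw [← hn] at hlow
  have hmR : (4 : ℝ) ≤ m := by exact_mod_cast hm4
  have hnm : (m : ℝ) + 4 ≤ n := by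
    have : m + 4 ≤ n := by
      have : (2 : ℤ) ≤ J := by exact_mod_cast hJ2
      nlinarith
    exact_mod_cast this
  have hmain' := hmain m n
  obtain ⟨Mb, hMb, hb⟩ := sg_b hp0 hr0.le hr1.le (m : ℝ) n e he
  set w : Fin 4 → ℝ := ![1, r, r, r ^ 2] with hwd
  set N : Fin 4 → ℝ := ![0, (m : ℝ), n, m + n] with hNd
  have hw : ∀ i, 0 < w i := by
    intro i; fin_cases i <;> simp [hwd] <;> positivity
  have hw1 : ∀ i, w i ≤ 1 := by
    intro i
    fin_cases i
    · exact le_rfl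
    · exact hr1.le
    · exact hr1.le
    · exact pow_le_one₀ hr0.le hr1.le
  have hN : ∀ i j, i ≠ j → 4 ≤ |N i - N j| := by
    intro i j hij
    rw [le_abs']
    fin_cases i <;> fin_cases j <;> first | exact absurd rfl hij | skip
    all_goals simp [hNd]
    all_goals first | (left; linarith) | (right; linarith)
  obtain ⟨Me, hMe, hE⟩ := sg_e w N e p hp he hw hw1 hN
  obtain ⟨μ, hμ0, hμf, hμ⟩ := sg_measure w N hw e p
  refine ⟨μ, hμ0, hμf, ?_⟩
  obtain ⟨b, hbd⟩ : ∃ b : ℝ → EuclideanSpace ℝ (Fin d) → ℂ, ∀ t, b t =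
      𝓕 (fun x => ((sgG w N e p t x : ℝ) : ℂ)) := ⟨_, fun _ => rfl⟩
  obtain ⟨E, hEd⟩ : ∃ E : ℝ → EuclideanSpace ℝ (Fin d) → ℂ, ∀ t, E t =
      𝓕 (fun x => ((sgS w N e p t x ^ (1 / p) - sgG w N e p t x : ℝ) : ℂ)) := ⟨_, fun _ => rfl⟩
  have hb := hb b hbd
  have hE := hE E hEd
  simp only [← hbd] at hmain'
  have hF : ∀ t, 0 ≤ t → (𝓕 fun x => ((slidingGaussian d μ t x ^ (1 / p) : ℝ) : ℂ)) =
      fun ξ => b t ξ + E t ξ := by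
    intro t ht
    funext ξ
    simp only [hμ]
    rw [(hE t t ht le_rfl).2.2.2.2.2.2 ξ, ← hbd]
  have hsq : ∀ t, 0 ≤ t → Integrable fun ξ => ‖b t ξ + E t ξ‖ ^ 2 := by
    intro t ht
    refine (((hb t t).2.2.1.const_mul 2).add ((hE t t ht le_rfl).2.2.1.const_mul 2)).mono'
      (((hb t t).1.add (hE t t ht le_rfl).1).norm.pow 2).aestronglyMeasurable (ae_of_all _ fun ξ => ?_)
    rw [Real.norm_of_nonneg (by positivity)]
    have h1 := norm_add_le (b t ξ) (E t ξ)
    have h2 := pow_le_pow_left₀ (norm_nonneg _) h1 2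
    simp only [Pi.add_apply]
    nlinarith [sq_nonneg (‖b t ξ‖ - ‖E t ξ‖)]
  have hQ : ∀ t, 0 ≤ t → Qtilde d μ p q t = (∫ ξ, ‖b t ξ + E t ξ‖ ^ q) ^ (1 / q) := by
    intro t ht
    have hcont : Continuous fun ξ => b t ξ + E t ξ := (hb t t).1.add (hE t t ht le_rfl).1
    have hint : Integrable fun ξ => ‖b t ξ + E t ξ‖ ^ q :=
      sg_rpow_int (M := Mb + Me) hq2 _ hcont (fun ξ => (norm_add_le _ _).trans
        (add_le_add ((hb t t).2.1 ξ) ((hE t t ht le_rfl).2.1 ξ))) (hsq t ht)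
    have hqr : (ENNReal.ofReal q).toReal = q := ENNReal.toReal_ofReal (by linarith)
    have hq0 : ENNReal.ofReal q ≠ 0 := by
      rw [Ne, ENNReal.ofReal_eq_zero]; linarith
    have hmem : MemLp (fun ξ => b t ξ + E t ξ) (ENNReal.ofReal q) volume := by
      refine (integrable_norm_rpow_iff hcont.aestronglyMeasurable hq0 ENNReal.ofReal_ne_top).1 ?_
      rwa [hqr]
    rw [Qtilde, hF t ht, hmem.eLpNorm_eq_integral_rpow_norm hq0 ENNReal.ofReal_ne_top, hqr,
      ENNReal.toReal_ofReal (by positivity), one_div]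
  set Φ : ℝ → ℝ := fun t => ∫ ξ, ‖b t ξ + E t ξ‖ ^ q with hΦ
  have hαβ : π / (p * q) < π / (2 * p) := by
    apply div_lt_div_of_pos_left Real.pi_pos (by positivity)
    nlinarith
  have hα : 0 < π / (p * q) := by positivity
  have hβ : 0 < π / (2 * p) := by positivity
  obtain ⟨T, hT0, hT⟩ : ∃ T : ℝ, 0 ≤ T ∧ ∀ t, T ≤ t → Real.exp (-(π / (p * q)) * t ^ 2) ≤ X₀ := by
    refine ⟨1 + |Real.log X₀| / (π / (p * q)), by positivity, fun t ht => ?_⟩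
    rw [← Real.le_log_iff_exp_le hX₀]
    have k0 : 0 ≤ |Real.log X₀| / (π / (p * q)) := by positivity
    have k1 : |Real.log X₀| / (π / (p * q)) ≤ t ^ 2 := by nlinarith
    rw [div_le_iff₀ hα] at k1
    have := neg_abs_le (Real.log X₀)
    linarith
  have hstep := sg_step (α := π / (p * q)) (β := π / (2 * p)) (c := C0 * c)
    (C := q * q * (2 * (Mb + Me)) ^ (q - 2) * (11 * (Mb + Me))) (T := T) (Φ := Φ) hα hαβ (by positivity)
    (by positivity) (fun t s ht hts => by
      have ht0 : 0 ≤ t := hT0.trans ht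
      have hs0 : 0 ≤ s := ht0.trans hts.le
      have hts2 : t ^ 2 ≤ s ^ 2 := pow_le_pow_left₀ ht0 hts.le 2
      obtain ⟨cb', mb', ib', jb', idb, jdb⟩ := hb t s
      obtain ⟨cb, mb, ib, jb, -, -⟩ := hb s s
      obtain ⟨ce', me', ie', je', ide, jde, -⟩ := hE t s ht0 hts.le
      obtain ⟨ce, me, ie, je, -, -, -⟩ := hE s s hs0 le_rfl
      set ε := Real.exp (-(π / (2 * p)) * t ^ 2) with hε
      have hε0 : 0 < ε := Real.exp_pos _
      have hε1 : ε ≤ 1 := by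
        refine Real.exp_le_one_iff.2 ?_
        have : 0 ≤ π / (2 * p) * t ^ 2 := by positivity
        linarith
      have hεs : Real.exp (-(π / (2 * p)) * s ^ 2) ≤ ε := by
        exact Real.exp_le_exp.2 (mul_le_mul_of_nonpos_left hts2 (by linarith only [hα, hβ]))
      have hεs2 : Real.exp (-(π / (2 * p)) * s ^ 2) ^ 2 ≤ ε ^ 2 :=
        pow_le_pow_left₀ (Real.exp_pos _).le hεs 2
      have u1 : 0 ≤ Mb * ε ^ 2 := by positivity
      have u2 : 0 ≤ Mb * (ε * (s - t)) ^ 2 := by positivity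
      have u3 : 0 ≤ Me * (s - t) ^ 2 := by positivity
      have u4 : Me * Real.exp (-(π / (2 * p)) * s ^ 2) ^ 2 ≤ Me * ε ^ 2 :=
        mul_le_mul_of_nonneg_left hεs2 hMe.le
      have herr := sg_error (M := Mb + Me) (K := Mb + Me) (ε := ε) (h := s - t) hq2 (by positivity) hε0 hε1
        (sub_pos.2 hts) (b s) (b t) (E s) (E t) cb cb' ce ce'
        (fun ξ => (mb ξ).trans (by linarith)) (fun ξ => (mb' ξ).trans (by linarith))
        (fun ξ => (me ξ).trans (by linarith)) (fun ξ => (me' ξ).trans (by linarith))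
        ib ib' ie ie' ide idb (by linarith) (by linarith) (by linarith) (by linarith) (by linarith) (by linarith)
      have hYX : Real.exp (-(π / (p * q)) * s ^ 2) ≤ Real.exp (-(π / (p * q)) * t ^ 2) := by
        exact Real.exp_le_exp.2 (mul_le_mul_of_nonpos_left hts2 (by linarith only [hα, hβ]))
      have hsum : ∀ t, HasSum (fun z : ℤ × ℤ => sgCoef (q / 2) r z.1 * sgCoef (q / 2) r z.2 *
          Real.exp (-(π / (p * q)) * t ^ 2) ^ ((m * z.1 + n * z.2).natAbs ^ 2))
          (C0⁻¹ * ∫ ξ, ‖b t ξ‖ ^ q) := by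
        intro t
        have := (hmain' t).mul_left C0⁻¹
        simpa only [inv_mul_cancel_left₀ hC0.ne'] using this
      have hl := hlow _ _ _ _ (Real.exp_pos _) hYX (hT t ht) (hsum t) (hsum s)
      rw [← mul_sub, inv_mul_eq_div, le_div_iff₀ hC0] at hl
      have := (abs_le.1 herr).1
      simp only [hΦ]
      linarith)
  obtain ⟨t₀, ht₀, hmono⟩ := hstep
  refine ⟨t₀, ht₀, fun t ht s hs hts => ?_⟩
  have ht0 : 0 ≤ t := (ht₀.trans ht).le
  rw [hQ t ht0, hQ s (ht0.trans hts.le)]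
  exact Real.rpow_lt_rpow (integral_nonneg fun _ => by positivity) (hmono ht hs hts) (by positivity)

/-- if `2 ≤ q ≤ p' ≤ ∞` and `q` is not an even integer, then there is a positive
finite Borel measure `μ` on `ℝ^d` such that `Q̃_{p,q}` is strictly increasing for large `t`. -/
theorem statement1 (d : ℕ) (hd : 0 < d) (p q : ℝ) (hp : 1 ≤ p) (hq : 2 ≤ q)
    (hqp : 1 - 1 / p ≤ 1 / q) (hqodd : ∀ k : ℕ, q ≠ 2 * k) :
    ∃ μ : Measure (EuclideanSpace ℝ (Fin d)), μ ≠ 0 ∧ IsFiniteMeasure μ ∧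
      ∃ t₀ > 0, StrictMonoOn (Qtilde d μ p q) (Set.Ioi t₀) := by
  exact sg_final p q hp hq hqodd (EuclideanSpace.single ⟨0, hd⟩ 1) (by simp)
end

section
/- Let m and n be coprime positive integers, let α₀, β₀ be integers with α₀m + β₀n = 1, and define α∗ = min{|α₀ + Nn| : N ∈ ℤ} and β∗ = min{|β₀ − Nm| : N ∈ ℤ}. Then the set Λ_{k,k'} is empty whenever (k' ≥ 0 and 0 ≤ k ≤ min{α∗, β∗} − 1) or (k ≥ 0 and 0 ≤ k' ≤ min{α∗, β∗} − 1). -/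
/-- The index set `Λ_{k,k'}` of quadruples `((j₁,j₂),(j₁',j₂'))` with `j₁+j₂ = k`,
`j₁'+j₂' = k'` and `m(j₁-j₁') + n(j₂-j₂') = ±1`. -/
def Lam (m n : ℤ) (k k' : ℕ) : Set ((ℕ × ℕ) × (ℕ × ℕ)) :=
  { j | j.1.1 + j.1.2 = k ∧ j.2.1 + j.2.2 = k' ∧
      (m * ((j.1.1 : ℤ) - (j.2.1 : ℤ)) + n * ((j.1.2 : ℤ) - (j.2.2 : ℤ)) = 1 ∨
        m * ((j.1.1 : ℤ) - (j.2.1 : ℤ)) + n * ((j.1.2 : ℤ) - (j.2.2 : ℤ)) = -1) }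

/-- for `m, n` coprime positive integers, `α₀m + β₀n = 1`,
`α∗ = min{|α₀ + Nn| : N ∈ ℤ}` and `β∗ = min{|β₀ - Nm| : N ∈ ℤ}`, the set `Λ_{k,k'}` is empty
whenever `0 ≤ k ≤ min{α∗,β∗} - 1` or `0 ≤ k' ≤ min{α∗,β∗} - 1`. -/
theorem statement10 (m n : ℤ) (hm : 0 < m) (hn : 0 < n) (hmn : IsCoprime m n)
    (α₀ β₀ : ℤ) (h₀ : α₀ * m + β₀ * n = 1) (αs βs : ℤ)
    (hα : IsLeast {x : ℤ | ∃ N : ℤ, x = |α₀ + N * n|} αs)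
    (hβ : IsLeast {x : ℤ | ∃ N : ℤ, x = |β₀ - N * m|} βs)
    (k k' : ℕ)
    (hkk : (k : ℤ) ≤ min αs βs - 1 ∨ (k' : ℤ) ≤ min αs βs - 1) :
    Lam m n k k' = ∅ := by
  have key : ∀ a b : ℤ, (m * a + n * b = 1 ∨ m * a + n * b = -1) → αs ≤ |a| ∧ βs ≤ |b| := by
    intro a b hab
    rcases hab with h | h
    · constructor
      · refine hα.2 ⟨β₀ * a - α₀ * b, ?_⟩
        congr 1
        linear_combination α₀ * h - a * h₀
      · refine hβ.2 ⟨β₀ * a - α₀ * b, ?_⟩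
        congr 1
        linear_combination β₀ * h - b * h₀
    · constructor
      · refine hα.2 ⟨-(β₀ * a - α₀ * b), ?_⟩
        rw [← abs_neg a]
        congr 1
        linear_combination -α₀ * h + a * h₀
      · refine hβ.2 ⟨-(β₀ * a - α₀ * b), ?_⟩
        rw [← abs_neg b]
        congr 1
        linear_combination -β₀ * h + b * h₀
  ext ⟨⟨p, q⟩, ⟨p', q'⟩⟩
  simp only [Lam, Set.mem_setOf_eq, Set.mem_empty_iff_false, iff_false]
  rintro ⟨h1, h2, h3⟩
  obtain ⟨ha, hb⟩ := key _ _ h3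
  have hA := min_le_left αs βs
  have hB := min_le_right αs βs
  generalize min αs βs = μ at *
  rcases hkk with hk | hk
  · have h4 : (p : ℤ) - p' ≤ -1 := by
      rcases le_abs'.1 ha with h | h <;> omega
    have h5 : (q : ℤ) - q' ≤ -1 := by
      rcases le_abs'.1 hb with h | h <;> omega
    rcases h3 with h3 | h3 <;> nlinarith
  · have h4 : 1 ≤ (p : ℤ) - p' := by
      rcases le_abs'.1 ha with h | h <;> omega
    have h5 : 1 ≤ (q : ℤ) - q' := by
      rcases le_abs'.1 hb with h | h <;> omega
    rcases h3 with h3 | h3 <;> nlinarith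
end

section
/- Let k₀ be a positive even integer, let m = 3k₀ + 1 and n = 2m + 3. Then m and n are coprime, ((2m+1)/3)·m + (−(m−1)/3)·n = 1, and with α₀ = (2m+1)/3, β₀ = −(m−1)/3 one has α∗ := min{|α₀ + Nn| : N ∈ ℤ} = 2k₀ + 1 and β∗ := min{|β₀ − Nm| : N ∈ ℤ} = k₀. Moreover n − m is even and the set Λ_{2k₀+1, k₀} is nonempty. -/
/-- let `k₀` be a positive even integer, `m = 3k₀+1`, `n = 2m+3`. Then `m` and `n`
are coprime, `((2m+1)/3)m + (-(m-1)/3)n = 1`, and with `α₀ = (2m+1)/3`, `β₀ = -(m-1)/3` one has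
`α∗ = 2k₀+1`, `β∗ = k₀`; moreover `n - m` is even and `Λ_{2k₀+1,k₀}` is nonempty. -/
theorem statement12 (k₀ : ℕ) (hk₀ : 0 < k₀) (hk₀e : Even k₀) :
    IsCoprime (3 * (k₀ : ℤ) + 1) (2 * (3 * (k₀ : ℤ) + 1) + 3) ∧
      ((2 * (3 * (k₀ : ℤ) + 1) + 1) / 3) * (3 * (k₀ : ℤ) + 1) +
        (-((3 * (k₀ : ℤ) + 1 - 1) / 3)) * (2 * (3 * (k₀ : ℤ) + 1) + 3) = 1 ∧
      IsLeast {x : ℤ | ∃ N : ℤ,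
        x = |(2 * (3 * (k₀ : ℤ) + 1) + 1) / 3 + N * (2 * (3 * (k₀ : ℤ) + 1) + 3)|}
        (2 * (k₀ : ℤ) + 1) ∧
      IsLeast {x : ℤ | ∃ N : ℤ,
        x = |(-((3 * (k₀ : ℤ) + 1 - 1) / 3)) - N * (3 * (k₀ : ℤ) + 1)|} (k₀ : ℤ) ∧
      Even ((2 * (3 * (k₀ : ℤ) + 1) + 3) - (3 * (k₀ : ℤ) + 1)) ∧
      (Lam (3 * (k₀ : ℤ) + 1) (2 * (3 * (k₀ : ℤ) + 1) + 3) (2 * k₀ + 1) k₀).Nonempty := by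
  have h1 : (2 * (3 * (k₀ : ℤ) + 1) + 1) / 3 = 2 * k₀ + 1 := by omega
  have h2 : (3 * (k₀ : ℤ) + 1 - 1) / 3 = k₀ := by omega
  rw [h1, h2]
  have hk : (0 : ℤ) < k₀ := by exact_mod_cast hk₀
  refine ⟨⟨2 * k₀ + 1, -k₀, by ring⟩, by ring, ⟨⟨0, ?_⟩, ?_⟩, ⟨⟨0, ?_⟩, ?_⟩, ?_,
    ⟨((2 * k₀ + 1, 0), (0, k₀)), ?_⟩⟩
  · rw [zero_mul, add_zero, abs_of_pos (by omega)]
  · rintro x ⟨N, rfl⟩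
    rw [le_abs]
    rcases le_or_gt 0 N with hN | hN
    · left; nlinarith
    · right; nlinarith
  · rw [zero_mul, sub_zero, abs_neg, abs_of_pos hk]
  · rintro x ⟨N, rfl⟩
    rw [le_abs]
    rcases le_or_gt 0 N with hN | hN
    · right; nlinarith
    · left; nlinarith
  · obtain ⟨r, rfl⟩ := hk₀e
    exact ⟨3 * r + 2, by push_cast; ring⟩
  · refine ⟨by simp, by simp, Or.inl ?_⟩
    push_cast
    ring
end
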